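/- arXiv:1703.04465 — 3 statements merged into one kernel-verified Lean document; each statement's English description precedes it below -/
import Mathlib

section
/- Let b ∈ (1/2, 1), set θ = (b − 3/8)/b and θ₀ = θ/4 + (1−θ)(1−2b)/2, and assume θ₀ > 0 (this holds for b sufficiently close to 1/2). Let ψ ∈ C_c^∞(ℝ). There exists a constant C = C(b,ψ) such that for every δ ∈ (0,1) and every f : 𝕋 × ℝ → ℂ smooth and compactly supported in the time variable, ‖ψ(t/δ) f‖_{L⁴(𝕋×ℝ)} ≤ C δ^{θ₀} ‖f‖_{X^{0,b}}. -/
open MeasureTheory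

/-- The `k`-th Fourier coefficient `Φ̂(k) = ∫_𝕋 Φ(x) e^{-2πikx} dx` of a 1-periodic
function `Φ : ℝ → ℂ`. -/
noncomputable def torusCoeff (Φ : ℝ → ℂ) (k : ℤ) : ℂ :=
  ∫ x in (0:ℝ)..1, Φ x * Complex.exp (-(2 * (Real.pi : ℂ)) * Complex.I * (k : ℂ) * (x : ℂ))

/-- The spacetime Fourier transform `f̃(k,η) = ∫_ℝ ∫_𝕋 f(x,t) e^{-2πi(kx+ηt)} dx dt` of
`f : 𝕋 × ℝ → ℂ` (a function `ℝ → ℝ → ℂ`, 1-periodic in the first variable). -/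
noncomputable def stFT (f : ℝ → ℝ → ℂ) (k : ℤ) (η : ℝ) : ℂ :=
  ∫ t : ℝ, ∫ x in (0:ℝ)..1,
    f x t * Complex.exp (-(2 * (Real.pi : ℂ)) * Complex.I * ((k : ℂ) * (x : ℂ) + (η : ℂ) * (t : ℂ)))

/-- The `X^{σ,b}` norm
`‖f‖_{X^{σ,b}} = (∑ₖ ∫ (1+|2πk|)^{2σ} (1+|η+2πk²|)^{2b} |f̃(k,η)|² dη)^{1/2}`,
valued in `ℝ≥0∞`. -/
noncomputable def XNorm (σ b : ℝ) (f : ℝ → ℝ → ℂ) : ENNReal :=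
  (∑' k : ℤ, ∫⁻ η : ℝ, ENNReal.ofReal
      ((1 + |2 * Real.pi * (k : ℝ)|) ^ (2 * σ) *
        (1 + |η + 2 * Real.pi * (k : ℝ) ^ 2|) ^ (2 * b) * ‖stFT f k η‖ ^ 2)) ^ ((1:ℝ)/2)

/-- The Sobolev norm `‖Φ‖_{H^σ} = (∑ₖ (1+|2πk|)^{2σ} |Φ̂(k)|²)^{1/2}`, valued in `ℝ≥0∞`. -/
noncomputable def HNorm (σ : ℝ) (Φ : ℝ → ℂ) : ENNReal :=
  (∑' k : ℤ, ENNReal.ofReal ((1 + |2 * Real.pi * (k : ℝ)|) ^ (2 * σ) * ‖torusCoeff Φ k‖ ^ 2))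
    ^ ((1:ℝ)/2)

/-- `f : 𝕋 × ℝ → ℂ` smooth (1-periodic in space) and compactly supported in time. -/
def SmoothCptTime (f : ℝ → ℝ → ℂ) : Prop :=
  ContDiff ℝ (⊤ : ℕ∞) (fun p : ℝ × ℝ => f p.1 p.2) ∧ (∀ x t, f (x + 1) t = f x t) ∧
    ∃ T : ℝ, ∀ x t : ℝ, T ≤ |t| → f x t = 0


/-- The `L⁴(𝕋 × ℝ)` norm `(∫_ℝ ∫_𝕋 |g(x,t)|⁴ dx dt)^{1/4}`, valued in `ℝ≥0∞`. -/
noncomputable def L4Norm (g : ℝ → ℝ → ℂ) : ENNReal :=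
  (∫⁻ t : ℝ, ∫⁻ x in Set.Ioc (0:ℝ) 1, ENNReal.ofReal (‖g x t‖ ^ 4)) ^ ((1:ℝ)/4)

noncomputable def ex (y : ℝ) : ℂ := Complex.exp (((2 * Real.pi * y : ℝ) : ℂ) * Complex.I)

lemma ex_add (x y : ℝ) : ex (x + y) = ex x * ex y := by
  unfold ex; rw [← Complex.exp_add]; congr 1; push_cast; ring

lemma norm_ex (x : ℝ) : ‖ex x‖ = 1 := Complex.norm_exp_ofReal_mul_I _

lemma conj_ex (x : ℝ) : (starRingEnd ℂ) (ex x) = ex (-x) := by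
  unfold ex; rw [← Complex.exp_conj]; congr 1
  rw [map_mul, Complex.conj_ofReal, Complex.conj_I]; push_cast; ring

lemma ex_int (n : ℤ) : ex n = 1 := by
  unfold ex
  rw [Complex.exp_eq_one_iff]
  exact ⟨n, by push_cast; ring⟩

@[fun_prop]
lemma continuous_ex : Continuous ex := by unfold ex; fun_prop

lemma orth (n : ℤ) : ∫ x in (0:ℝ)..1, ex (n * x) = if n = 0 then 1 else 0 := by
  split_ifs with h
  · subst h; simp [ex]
  · have hc : (2 * Real.pi * n * Complex.I : ℂ) ≠ 0 := by
      simp [h, Real.pi_ne_zero]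
    have := integral_exp_mul_complex (a := 0) (b := 1) hc
    have e : ∀ x : ℝ, ex (n * x) = Complex.exp (2 * Real.pi * n * Complex.I * x) := by
      intro x; unfold ex; congr 1; push_cast; ring
    simp_rw [e]
    rw [this]
    have h1 : Complex.exp (2 * Real.pi * n * Complex.I * (1:ℝ)) = 1 := by
      rw [← e, mul_one, ex_int]
    rw [h1]; simp

lemma sq_eq (z : ℂ) : ((‖z‖ ^ 2 : ℝ) : ℂ) = z * (starRingEnd ℂ) z := by
  rw [Complex.mul_conj, Complex.normSq_eq_norm_sq]

lemma parseval (S : Finset ℤ) (a : ℤ → ℂ) :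
    ∫ x in (0:ℝ)..1, ‖∑ k ∈ S, a k * ex (k * x)‖ ^ 2 = ∑ k ∈ S, ‖a k‖ ^ 2 := by
  apply Complex.ofReal_injective
  rw [← intervalIntegral.integral_ofReal]
  simp_rw [sq_eq, map_sum, map_mul, conj_ex, Finset.sum_mul_sum]
  rw [intervalIntegral.integral_finsetSum]
  · rw [Complex.ofReal_sum]
    refine Finset.sum_congr rfl fun k hk => ?_
    rw [intervalIntegral.integral_finsetSum]
    · have : ∀ l ∈ S, ∫ x in (0:ℝ)..1, a k * ex (k * x) * ((starRingEnd ℂ) (a l) * ex (-(l * x)))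
          = if k = l then a k * (starRingEnd ℂ) (a l) else 0 := by
        intro l _
        have : ∀ x : ℝ, a k * ex (k * x) * ((starRingEnd ℂ) (a l) * ex (-(l * x)))
            = a k * (starRingEnd ℂ) (a l) * ex ((k - l : ℤ) * x) := by
          intro x
          rw [show (((k - l : ℤ) : ℝ) * x) = k * x + -(l * x) by push_cast; ring, ex_add]; ring
        simp_rw [this]
        rw [intervalIntegral.integral_const_mul, orth]
        simp [sub_eq_zero]
      rw [Finset.sum_congr rfl this, Finset.sum_ite_eq, if_pos hk, ← sq_eq]
    · intro l _; apply Continuous.intervalIntegrable; fun_prop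
  · intro l _; apply Continuous.intervalIntegrable; fun_prop

lemma window_pos (S : Finset ℤ) (a : ℤ → ℂ) (ν L : ℝ) (hν : 0 < ν) (hL : 0 ≤ L) :
    ∫ t in (-L)..L, ‖∑ k ∈ S, a k * ex (k * (ν * t))‖ ^ 2
      ≤ (2 * L + 2 / ν) * ∑ k ∈ S, ‖a k‖ ^ 2 := by
  set Q : ℝ → ℝ := fun s => ‖∑ k ∈ S, a k * ex (k * s)‖ ^ 2 with hQ
  have hQc : Continuous Q := by fun_prop
  have hper : Function.Periodic Q 1 := by
    intro s
    simp only [hQ]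
    congr 2
    refine Finset.sum_congr rfl fun k _ => ?_
    rw [mul_add, mul_one, ex_add, ex_int, mul_one]
  have h1 : ∫ t in (-L)..L, Q (ν * t) = ν⁻¹ * ∫ s in (ν * (-L))..(ν * L), Q s := by
    rw [intervalIntegral.integral_comp_mul_left _ hν.ne']; rfl
  change ∫ t in (-L)..L, Q (ν * t) ≤ _
  rw [h1]
  set j : ℕ := ⌈ν * L⌉₊ with hj
  have hj1 : ν * L ≤ j := Nat.le_ceil _
  have hj2 : (j:ℝ) ≤ ν * L + 1 := (Nat.ceil_lt_add_one (by positivity)).le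
  have h2 : ∫ s in (ν * (-L))..(ν * L), Q s ≤ ∫ s in (-j : ℝ)..j, Q s := by
    apply intervalIntegral.integral_mono_interval
    · linarith
    · nlinarith
    · exact hj1
    · exact Filter.Eventually.of_forall fun s => by positivity
    · exact hQc.intervalIntegrable _ _
  have h3 : ∫ s in (-j : ℝ)..j, Q s = (2 * j) * ∑ k ∈ S, ‖a k‖ ^ 2 := by
    have := hper.intervalIntegral_add_zsmul_eq (2 * j : ℤ) (-j : ℝ) (fun _ _ => hQc.intervalIntegrable _ _)
    rw [show (-(j:ℝ) + (2 * j : ℤ) • (1:ℝ)) = j by simp; ring] at this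
    rw [this, hper.intervalIntegral_add_eq (-(j:ℝ)) 0, zero_add, parseval]
    simp
  rw [h3] at h2
  have h0 : 0 ≤ ∑ k ∈ S, ‖a k‖ ^ 2 := by positivity
  calc _ ≤ ν⁻¹ * ((2 * j) * ∑ k ∈ S, ‖a k‖ ^ 2) := by gcongr
    _ ≤ ν⁻¹ * ((2 * (ν * L + 1)) * ∑ k ∈ S, ‖a k‖ ^ 2) := by gcongr
    _ = _ := by field_simp

lemma window (S : Finset ℤ) (a : ℤ → ℂ) (ν L : ℝ) (hν : ν ≠ 0) (hL : 0 ≤ L) :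
    ∫ t in (-L)..L, ‖∑ k ∈ S, a k * ex (k * (ν * t))‖ ^ 2
      ≤ (2 * L + 2 / |ν|) * ∑ k ∈ S, ‖a k‖ ^ 2 := by
  rcases lt_or_gt_of_ne hν with h | h
  · have := window_pos S a (-ν) L (by linarith) hL
    rw [abs_of_neg h]
    refine le_trans (le_of_eq ?_) this
    have h2 := intervalIntegral.integral_comp_neg (a := -L) (b := L)
      (fun t : ℝ => ‖∑ k ∈ S, a k * ex (k * (ν * t))‖ ^ 2)
    rw [neg_neg] at h2
    rw [← h2]
    simp
  · rw [abs_of_pos h]; exact window_pos S a ν L h hL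

/-- the free wave -/
noncomputable def fw (N : ℕ) (g : ℤ → ℂ) (x t : ℝ) : ℂ :=
  ∑ k ∈ Finset.Icc (-(N:ℤ)) N, g k * ex (k * x - 2 * Real.pi * k ^ 2 * t)

lemma fw_sq (N : ℕ) (g : ℤ → ℂ) (hg : ∀ k ∉ Finset.Icc (-(N:ℤ)) N, g k = 0) (x t : ℝ) :
    ((‖fw N g x t‖ ^ 2 : ℝ) : ℂ) = ∑ n ∈ Finset.Icc (-(2 * N:ℤ)) (2 * N),
      (ex (-(2 * Real.pi * n ^ 2 * t)) * ∑ l ∈ Finset.Icc (-(N:ℤ)) N,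
        (g (l + n) * (starRingEnd ℂ) (g l)) * ex (l * (-(4 * Real.pi * n) * t))) * ex (n * x) := by
  rw [sq_eq]
  unfold fw
  simp_rw [map_sum, map_mul, conj_ex, Finset.sum_mul_sum]
  rw [Finset.sum_comm]
  simp_rw [Finset.mul_sum, Finset.sum_mul]
  rw [Finset.sum_comm (s := Finset.Icc (-(2 * N:ℤ)) (2 * N))]
  refine Finset.sum_congr rfl fun l hl => ?_
  rw [Finset.mem_Icc] at hl
  symm
  rw [← Finset.sum_subset (s₁ := (Finset.Icc (-(N:ℤ)) N).image (fun k => k - l))]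
  · rw [Finset.sum_image (by intro a _ b _ h; simpa using h)]
    refine Finset.sum_congr rfl fun k hk => ?_
    rw [show l + (k - l) = k by ring]
    have : ex (k * x - 2 * Real.pi * k ^ 2 * t) * ex (-(l * x - 2 * Real.pi * l ^ 2 * t))
       = ex (-(2 * Real.pi * ((k - l : ℤ):ℝ) ^ 2 * t)) * ex (l * (-(4 * Real.pi * ((k - l : ℤ):ℝ)) * t))
        * ex (((k - l : ℤ):ℝ) * x) := by
      rw [← ex_add, ← ex_add, ← ex_add]; congr 1; push_cast; ring
    linear_combination (-(g k * (starRingEnd ℂ) (g l))) * this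
  · intro n hn
    simp only [Finset.mem_image, Finset.mem_Icc] at hn ⊢
    obtain ⟨k, hk, rfl⟩ := hn
    omega
  · intro n _ hn
    rw [hg (l + n)]
    · simp
    · intro h; apply hn
      exact Finset.mem_image.2 ⟨l + n, h, by ring⟩

/-- the quadratic coefficient -/
noncomputable def HH (N : ℕ) (g : ℤ → ℂ) (n : ℤ) (t : ℝ) : ℂ :=
  ∑ l ∈ Finset.Icc (-(N:ℤ)) N,
        (g (l + n) * (starRingEnd ℂ) (g l)) * ex (l * (-(4 * Real.pi * n) * t))

lemma fw_four (N : ℕ) (g : ℤ → ℂ) (hg : ∀ k ∉ Finset.Icc (-(N:ℤ)) N, g k = 0) (t : ℝ) :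
    ∫ x in (0:ℝ)..1, ‖fw N g x t‖ ^ 4 = ∑ n ∈ Finset.Icc (-(2 * N:ℤ)) (2 * N), ‖HH N g n t‖ ^ 2 := by
  have h : ∀ x, ‖fw N g x t‖ ^ 4 = ‖∑ n ∈ Finset.Icc (-(2 * N:ℤ)) (2 * N),
      (ex (-(2 * Real.pi * n ^ 2 * t)) * HH N g n t) * ex (n * x)‖ ^ 2 := by
    intro x
    unfold HH
    rw [← fw_sq N g hg x t, Complex.norm_real, Real.norm_of_nonneg (by positivity)]; ring
  simp_rw [h]
  rw [parseval _ (fun n => ex (-(2 * Real.pi * n ^ 2 * t)) * HH N g n t)]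
  simp [norm_ex]

lemma shift_sum (N : ℕ) (g : ℤ → ℂ) (hg : ∀ k ∉ Finset.Icc (-(N:ℤ)) N, g k = 0) (S : Finset ℤ) (n : ℤ) :
    ∑ l ∈ S, ‖g (l + n)‖ ^ 2 ≤ ∑ l ∈ Finset.Icc (-(N:ℤ)) N, ‖g l‖ ^ 2 := by
  rw [← Finset.sum_image (s := S) (g := fun l => l + n) (f := fun k => ‖g k‖ ^ 2)
    (by intro a _ b _ h; simpa using h)]
  rw [← Finset.sum_filter_add_sum_filter_not _ (fun k => k ∈ Finset.Icc (-(N:ℤ)) N)]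
  rw [Finset.sum_eq_zero (s := Finset.filter (fun k => ¬ k ∈ Finset.Icc (-(N:ℤ)) N) _), add_zero]
  · refine Finset.sum_le_sum_of_subset_of_nonneg ?_ (fun _ _ _ => by positivity)
    intro k hk; exact (Finset.mem_filter.1 hk).2
  · intro k hk; rw [hg k (Finset.mem_filter.1 hk).2]; simp

lemma HH_bound (N : ℕ) (g : ℤ → ℂ) (hg : ∀ k ∉ Finset.Icc (-(N:ℤ)) N, g k = 0) (n : ℤ) (t : ℝ) :
    ‖HH N g n t‖ ≤ ∑ l ∈ Finset.Icc (-(N:ℤ)) N, ‖g l‖ ^ 2 := by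
  have h1 := shift_sum N g hg (Finset.Icc (-(N:ℤ)) N) n
  calc ‖HH N g n t‖ ≤ ∑ l ∈ Finset.Icc (-(N:ℤ)) N, ‖g (l + n)‖ * ‖g l‖ := by
        refine (norm_sum_le _ _).trans (le_of_eq ?_)
        simp [norm_ex]
    _ ≤ ∑ l ∈ Finset.Icc (-(N:ℤ)) N, (‖g (l + n)‖ ^ 2 / 2 + ‖g l‖ ^ 2 / 2) := by
        refine Finset.sum_le_sum fun l _ => ?_
        nlinarith [sq_nonneg (‖g (l + n)‖ - ‖g l‖)]
    _ ≤ _ := by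
        rw [Finset.sum_add_distrib, ← Finset.sum_div, ← Finset.sum_div]; linarith

lemma free (N : ℕ) (g : ℤ → ℂ) (hg : ∀ k ∉ Finset.Icc (-(N:ℤ)) N, g k = 0) (R δ : ℝ) (hR : 0 < R)
    (hδ : 0 < δ) (hδ1 : δ < 1) :
    ∫ t in (-(R * δ))..(R * δ), ∫ x in (0:ℝ)..1, ‖fw N g x t‖ ^ 4
      ≤ (12 * R + 1) * δ ^ (1/2 : ℝ) * (∑ l ∈ Finset.Icc (-(N:ℤ)) N, ‖g l‖ ^ 2) ^ 2 := by
  simp_rw [fw_four N g hg]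
  set G := ∑ l ∈ Finset.Icc (-(N:ℤ)) N, ‖g l‖ ^ 2 with hG
  have hG0 : 0 ≤ G := by positivity
  have hc : ∀ n, Continuous (HH N g n) := by intro n; unfold HH; fun_prop
  rw [intervalIntegral.integral_finsetSum
    (fun n _ => (show Continuous (fun t => ‖HH N g n t‖ ^ 2) from (hc n).norm.pow 2).intervalIntegrable _ _)]
  set s := δ ^ (1/2 : ℝ) with hs
  have hs0 : 0 < s := by positivity
  have hss : s * s = δ := by rw [hs, ← Real.rpow_add hδ]; norm_num
  have hs1 : s < 1 := by nlinarith
  set M : ℕ := ⌈s⁻¹⌉₊ with hM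
  have hM1 : s⁻¹ ≤ M := Nat.le_ceil _
  have hM2 : (M : ℝ) ≤ s⁻¹ + 1 := (Nat.ceil_lt_add_one (by positivity)).le
  have hMs : 1 ≤ M * s := by rw [inv_le_iff_one_le_mul₀ hs0] at hM1; exact hM1
  have hM0 : (0:ℝ) < M := by by_contra h; push Not at h; nlinarith
  have small : ∀ n, ∫ t in (-(R * δ))..(R * δ), ‖HH N g n t‖ ^ 2 ≤ 2 * R * δ * G ^ 2 := by
    intro n
    have : ∫ t in (-(R * δ))..(R * δ), ‖HH N g n t‖ ^ 2 ≤ ∫ t in (-(R * δ))..(R * δ), G ^ 2 := by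
      apply intervalIntegral.integral_mono_on
      · nlinarith [mul_pos hR hδ]
      · exact ((hc n).norm.pow 2).intervalIntegrable _ _
      · simp
      · intro t _
        have := HH_bound N g hg n t
        gcongr
    refine this.trans (le_of_eq ?_)
    rw [intervalIntegral.integral_const, smul_eq_mul]; ring
  have big : ∀ n : ℤ, (M:ℤ) < |n| → ∫ t in (-(R * δ))..(R * δ), ‖HH N g n t‖ ^ 2
      ≤ (2 * R + 1) * s * ∑ l ∈ Finset.Icc (-(N:ℤ)) N, ‖g (l + n)‖ ^ 2 * ‖g l‖ ^ 2 := by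
    intro n hn
    have hn' : (M:ℝ) < |(n:ℝ)| := by exact_mod_cast hn
    have hn0 : (n:ℝ) ≠ 0 := by intro h; rw [h, abs_zero] at hn'; linarith
    have := window (Finset.Icc (-(N:ℤ)) N) (fun l => g (l + n) * (starRingEnd ℂ) (g l))
      (-(4 * Real.pi * n)) (R * δ) (by simp [hn0, Real.pi_ne_zero]) (by positivity)
    refine this.trans ?_
    simp only [norm_mul, RCLike.norm_conj, mul_pow]
    gcongr
    have h1 : 2 / |-(4 * Real.pi * (n:ℝ))| ≤ s := by
      rw [abs_neg, abs_mul, abs_of_pos (by positivity : (0:ℝ) < 4 * Real.pi), div_le_iff₀ (by positivity)]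
      have : 1 ≤ s * |(n:ℝ)| := by nlinarith
      nlinarith [Real.pi_gt_three]
    have h2 : R * δ ≤ R * s := by
      apply mul_le_mul_of_nonneg_left _ hR.le
      nlinarith
    linarith
  have tot : ∑ n ∈ Finset.Icc (-(2 * N:ℤ)) (2 * N), ∑ l ∈ Finset.Icc (-(N:ℤ)) N, ‖g (l + n)‖ ^ 2 * ‖g l‖ ^ 2
      ≤ G ^ 2 := by
    rw [Finset.sum_comm]
    simp_rw [← Finset.sum_mul]
    calc _ ≤ ∑ l ∈ Finset.Icc (-(N:ℤ)) N, G * ‖g l‖ ^ 2 := by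
          refine Finset.sum_le_sum fun l _ => ?_
          gcongr
          have := shift_sum N g hg (Finset.Icc (-(2 * N:ℤ)) (2 * N)) l
          simpa [add_comm] using this
      _ = _ := by rw [← Finset.mul_sum, ← hG]; ring
  calc _ ≤ ∑ n ∈ Finset.Icc (-(2 * N:ℤ)) (2 * N), ((if n ∈ Finset.Icc (-(M:ℤ)) M then 2 * R * δ * G ^ 2 else 0)
        + (2 * R + 1) * s * ∑ l ∈ Finset.Icc (-(N:ℤ)) N, ‖g (l + n)‖ ^ 2 * ‖g l‖ ^ 2) := by
        refine Finset.sum_le_sum fun n _ => ?_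
        split_ifs with h
        · exact (small n).trans (le_add_of_nonneg_right (by positivity))
        · rw [zero_add]; apply big
          rw [Finset.mem_Icc, ← abs_le] at h; omega
    _ ≤ (2 * M + 1) * (2 * R * δ * G ^ 2) + (2 * R + 1) * s * G ^ 2 := by
        rw [Finset.sum_add_distrib, ← Finset.mul_sum]
        gcongr
        rw [← Finset.sum_filter, Finset.sum_const, nsmul_eq_mul]
        gcongr
        have : (Finset.filter (fun n => n ∈ Finset.Icc (-(M:ℤ)) M) (Finset.Icc (-(2 * N:ℤ)) (2 * N))).card
          ≤ (Finset.Icc (-(M:ℤ)) M).card := Finset.card_le_card (by intro k hk; exact (Finset.mem_filter.1 hk).2)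
        rw [Int.card_Icc] at this
        have h2 : ((Finset.filter (fun n => n ∈ Finset.Icc (-(M:ℤ)) M) (Finset.Icc (-(2 * N:ℤ)) (2 * N))).card)
          ≤ 2 * M + 1 := by omega
        exact_mod_cast h2
    _ ≤ _ := by
        have hMd : (2 * M + 1) * δ ≤ 5 * s := by
          have : M * s ≤ 1 + s := by
            have := mul_le_mul_of_nonneg_right hM2 hs0.le
            rwa [add_mul, inv_mul_cancel₀ hs0.ne', one_mul] at this
          rw [← hss]; nlinarith
        have : (2 * M + 1) * (2 * R * δ * G ^ 2) ≤ 10 * R * s * G ^ 2 := by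
          have := mul_le_mul_of_nonneg_left hMd (by positivity : 0 ≤ 2 * R * G ^ 2)
          nlinarith
        nlinarith

/-- Fourier coefficient -/
noncomputable def cc (φ : ℝ → ℂ) (k : ℤ) : ℂ := ∫ x in (0:ℝ)..1, φ x * ex (-(k * x))

lemma hasDerivAt_ex (k : ℤ) (x : ℝ) :
    HasDerivAt (fun x : ℝ => ex (-(k * x))) (-(2 * Real.pi * k * Complex.I) * ex (-(k * x))) x := by
  unfold ex
  have h : HasDerivAt (fun x : ℝ => (((2 * Real.pi * (-(k * x)) : ℝ) : ℂ) * Complex.I))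
      (-(2 * Real.pi * k * Complex.I)) x := by
    have h1 : HasDerivAt (fun x : ℝ => 2 * Real.pi * (-(k * x))) (2 * Real.pi * (-(k * 1))) x :=
      (((hasDerivAt_id x).const_mul (k:ℝ)).neg).const_mul _
    have h2 := (h1.ofReal_comp).mul_const Complex.I
    refine h2.congr_deriv ?_
    push_cast; ring
  have := h.cexp
  rwa [mul_comm (Complex.exp _)] at this

lemma cc_deriv (φ : ℝ → ℂ) (hφ : ContDiff ℝ 1 φ) (hper : ∀ x, φ (x + 1) = φ x) (k : ℤ) :
    cc (deriv φ) k = 2 * Real.pi * k * Complex.I * cc φ k := by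
  unfold cc
  have hd : ∀ x, HasDerivAt φ (deriv φ x) x := fun x => (hφ.differentiable (by simp) x).hasDerivAt
  have hdc : Continuous (deriv φ) := hφ.continuous_deriv (by simp)
  have := intervalIntegral.integral_deriv_mul_eq_sub (a := 0) (b := 1) (u := φ)
    (v := fun x : ℝ => ex (-(k * x))) (u' := deriv φ)
    (v' := fun x => -(2 * Real.pi * k * Complex.I) * ex (-(k * x)))
    (fun x _ => hd x) (fun x _ => hasDerivAt_ex k x) (hdc.intervalIntegrable _ _)
    (Continuous.intervalIntegrable (by fun_prop) _ _)
  rw [intervalIntegral.integral_add] at this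
  · have e0 : φ 1 = φ 0 := by simpa using hper 0
    have e1 : ex (-((k:ℝ) * 1)) = ex (-((k:ℝ) * 0)) := by
      rw [mul_one, mul_zero, neg_zero]
      have h1 := ex_int (-k)
      have h0 := ex_int 0
      push_cast at h1 h0
      rw [h1, h0]
    rw [e0, e1, sub_self] at this
    have e2 : ∀ x : ℝ, φ x * (-(2 * Real.pi * k * Complex.I) * ex (-(k * x)))
      = -(2 * Real.pi * k * Complex.I) * (φ x * ex (-(k * x))) := fun x => by ring
    simp_rw [e2] at this
    rw [intervalIntegral.integral_const_mul] at this
    linear_combination this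
  · exact Continuous.intervalIntegrable (by fun_prop) _ _
  · exact Continuous.intervalIntegrable (by have := hφ.continuous; fun_prop) _ _

lemma cc_bound (φ : ℝ → ℂ) (k : ℤ) : ‖cc φ k‖ ≤ ∫ x in (0:ℝ)..1, ‖φ x‖ := by
  unfold cc
  refine (intervalIntegral.norm_integral_le_integral_norm (by norm_num)).trans (le_of_eq ?_)
  simp [norm_ex]

lemma cc_summable (φ : ℝ → ℂ) (hφ : ContDiff ℝ 2 φ) (hper : ∀ x, φ (x + 1) = φ x) :
    Summable (cc φ) := by
  have hd1 : ContDiff ℝ 1 (deriv φ) := hφ.deriv' 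
  have hper1 : ∀ x, deriv φ (x + 1) = deriv φ x := by
    intro x
    rw [← deriv_comp_add_const]
    congr 1; funext y; exact hper y
  have h2 : ∀ k, cc (deriv (deriv φ)) k = (2 * Real.pi * k * Complex.I) ^ 2 * cc φ k := by
    intro k
    rw [cc_deriv _ hd1 hper1, cc_deriv _ (hφ.of_le (by norm_num)) hper]; ring
  set B := ∫ x in (0:ℝ)..1, ‖deriv (deriv φ) x‖
  have hs : Summable (fun k : ℤ => B * (1 / (k:ℝ) ^ 2)) :=
    (Real.summable_one_div_int_pow.2 (by norm_num : 1 < 2)).mul_left B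
  refine Summable.of_norm_bounded_eventually hs ?_
  have : ({0}ᶜ : Set ℤ) ∈ Filter.cofinite := (Set.finite_singleton _).compl_mem_cofinite
  filter_upwards [this] with k hk
  have hk0 : (k:ℝ) ≠ 0 := by simpa using hk
  have hk2 : 0 < (k:ℝ) ^ 2 := by positivity
  have h3 := cc_bound (deriv (deriv φ)) k
  rw [h2, norm_mul, norm_pow] at h3
  have h4 : ‖(2 * Real.pi * k * Complex.I : ℂ)‖ ^ 2 = (2 * Real.pi) ^ 2 * (k:ℝ) ^ 2 := by
    simp [mul_pow]
  rw [h4] at h3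
  rw [mul_one_div, le_div_iff₀ hk2]
  refine le_trans ?_ h3
  have : 1 ≤ (2 * Real.pi) ^ 2 := by nlinarith [Real.pi_gt_three]
  nlinarith [mul_nonneg (norm_nonneg (cc φ k)) hk2.le]

lemma cc_hasSum (φ : ℝ → ℂ) (hφ : ContDiff ℝ 2 φ) (hper : ∀ x, φ (x + 1) = φ x) (x : ℝ) :
    HasSum (fun k : ℤ => cc φ k * ex (k * x)) (φ x) := by
  have hp : Function.Periodic φ 1 := hper
  have : Fact ((0:ℝ) < 1) := ⟨one_pos⟩
  let F : C(AddCircle (1:ℝ), ℂ) := ⟨hp.lift, by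
    exact continuous_coinduced_dom.mpr hφ.continuous⟩
  have hF : ∀ y : ℝ, F (y : AddCircle (1:ℝ)) = φ y := fun y => hp.lift_coe y
  have hfx : ∀ (n : ℤ) (y : ℝ), fourier n (y : AddCircle (1:ℝ)) = ex (n * y) := by
    intro n y
    rw [fourier_coe_apply]; unfold ex; congr 1; push_cast; ring
  have hc : ∀ k, fourierCoeff F k = cc φ k := by
    intro k
    rw [fourierCoeff_eq_intervalIntegral F k 0]
    unfold cc
    simp only [hF, hfx, smul_eq_mul]
    simp [mul_comm]
  have hs : Summable (fourierCoeff F) := by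
    rw [show fourierCoeff F = cc φ from funext hc]; exact cc_summable φ hφ hper
  have := has_pointwise_sum_fourier_series_of_summable hs (x : AddCircle (1:ℝ))
  rw [hF] at this
  simpa only [hc, hfx, smul_eq_mul] using this

open scoped FourierTransform in
lemma stFT_eq (f : ℝ → ℝ → ℂ) (k : ℤ) (η : ℝ) :
    stFT f k η = 𝓕 (fun t => cc (fun x => f x t) k) η := by
  rw [Real.fourier_real_eq_integral_exp_smul]
  unfold stFT cc
  refine integral_congr_ae (Filter.Eventually.of_forall fun t => ?_)
  beta_reduce
  rw [smul_eq_mul, ← intervalIntegral.integral_const_mul]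
  refine intervalIntegral.integral_congr fun x _ => ?_
  unfold ex
  rw [mul_left_comm, ← Complex.exp_add]
  congr 2
  push_cast; ring

lemma cc_cont (f : ℝ → ℝ → ℂ) (hf : SmoothCptTime f) (k : ℤ) :
    Continuous (fun t => cc (fun x => f x t) k) := by
  unfold cc
  apply intervalIntegral.continuous_parametric_intervalIntegral_of_continuous'
  have h : Continuous (fun p : ℝ × ℝ => f p.1 p.2) := hf.1.continuous
  have h2 : Continuous (fun p : ℝ × ℝ => f p.2 p.1) := h.comp continuous_swap
  simp only [Function.uncurry_def]
  fun_prop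

lemma cc_integrable (f : ℝ → ℝ → ℂ) (hf : SmoothCptTime f) (k : ℤ) :
    Integrable (fun t => cc (fun x => f x t) k) := by
  apply (cc_cont f hf k).integrable_of_hasCompactSupport
  obtain ⟨T, hT⟩ := hf.2.2
  apply HasCompactSupport.intro (isCompact_Icc (a := -T) (b := T))
  intro t ht
  have : T ≤ |t| := by
    by_contra h
    push Not at h
    exact ht ⟨(abs_lt.1 h).1.le, (abs_lt.1 h).2.le⟩
  unfold cc
  simp [hT _ t this]

open scoped FourierTransform in
lemma stFT_cont (f : ℝ → ℝ → ℂ) (hf : SmoothCptTime f) (k : ℤ) :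
    Continuous (stFT f k) := by
  rw [show stFT f k = 𝓕 (fun t => cc (fun x => f x t) k) from funext (stFT_eq f k)]
  exact VectorFourier.fourierIntegral_continuous Real.continuous_fourierChar
    continuous_inner (cc_integrable f hf k)

open scoped FourierTransform in
lemma stFT_inv (f : ℝ → ℝ → ℂ) (hf : SmoothCptTime f) (k : ℤ) (hi : Integrable (stFT f k)) (t : ℝ) :
    cc (fun x => f x t) k = ∫ η : ℝ, stFT f k η * ex (η * t) := by
  have e : stFT f k = 𝓕 (fun t => cc (fun x => f x t) k) := funext (stFT_eq f k)
  have := (cc_cont f hf k).fourierInv_fourier_eq (cc_integrable f hf k) (e ▸ hi)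
  have h2 := congrFun this t
  rw [← e] at h2
  rw [← h2, Real.fourierInv_eq']
  refine integral_congr_ae (Filter.Eventually.of_forall fun η => ?_)
  simp only [smul_eq_mul]
  rw [mul_comm]; congr 1; unfold ex; congr 1
  simp; ring

lemma mink {α : Type*} [MeasurableSpace α] (μ : Measure α) [SFinite μ] (u : ℝ → α → ENNReal)
    (a : ℝ → ENNReal) (hu : Measurable (Function.uncurry u)) (ha : Measurable a)
    (hat : ∀ τ, a τ ≠ ⊤) (hz : ∀ τ p, a τ = 0 → u τ p = 0) (K : ENNReal)
    (hK : ∀ τ, ∫⁻ p, u τ p ^ 4 ∂μ ≤ K * a τ ^ 4) :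
    ∫⁻ p, (∫⁻ τ, u τ p) ^ 4 ∂μ ≤ K * (∫⁻ τ, a τ) ^ 4 := by
  have h1 : ∀ p, (∫⁻ τ, u τ p) ^ 4 ≤ (∫⁻ τ, a τ) ^ 3 * ∫⁻ τ, u τ p ^ 4 * (a τ ^ 3)⁻¹ := by
    intro p
    have hup : Measurable (fun τ => u τ p) := hu.comp (measurable_id.prodMk measurable_const)
    have hpq : Real.HolderConjugate 4 (4/3) := by
      rw [Real.holderConjugate_iff]; norm_num
    have hH := ENNReal.lintegral_mul_le_Lp_mul_Lq volume hpq
      (f := fun τ => u τ p * (a τ ^ (3/4 : ℝ))⁻¹) (g := fun τ => a τ ^ (3/4 : ℝ))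
      (hup.mul (ha.pow_const _).inv).aemeasurable (ha.pow_const _).aemeasurable
    have e1 : ∀ τ, ((fun τ => u τ p * (a τ ^ (3/4 : ℝ))⁻¹) * (fun τ => a τ ^ (3/4 : ℝ))) τ = u τ p := by
      intro τ
      simp only [Pi.mul_apply]
      by_cases h0 : a τ = 0
      · rw [hz τ p h0]; simp
      · rw [mul_assoc, ENNReal.inv_mul_cancel, mul_one]
        · simp [h0]; intro; norm_num
        · simp [h0, hat τ]
    have e2 : ∀ τ, (u τ p * (a τ ^ (3/4 : ℝ))⁻¹) ^ (4:ℝ) = u τ p ^ 4 * (a τ ^ 3)⁻¹ := by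
      intro τ
      rw [ENNReal.mul_rpow_of_nonneg _ _ (by norm_num), ENNReal.inv_rpow, ← ENNReal.rpow_mul]
      norm_num
    have e3 : ∀ τ, (a τ ^ (3/4 : ℝ)) ^ (4/3 : ℝ) = a τ := by
      intro τ
      rw [← ENNReal.rpow_mul]; norm_num
    simp only [e1, e2, e3] at hH
    calc _ ≤ ((∫⁻ τ, u τ p ^ 4 * (a τ ^ 3)⁻¹) ^ (1/4 : ℝ) * (∫⁻ τ, a τ) ^ (1 / (4/3) : ℝ)) ^ 4 := by
          gcongr
      _ = _ := by
          rw [mul_pow, ← ENNReal.rpow_natCast, ← ENNReal.rpow_natCast, ← ENNReal.rpow_mul,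
            ← ENNReal.rpow_mul, mul_comm, ← ENNReal.rpow_natCast]
          norm_num
  have hm : Measurable (Function.uncurry fun (p : α) τ => u τ p ^ 4 * (a τ ^ 3)⁻¹) := by
    apply Measurable.mul
    · exact (hu.comp measurable_swap).pow_const 4
    · exact ((ha.comp measurable_snd).pow_const 3).inv
  calc _ ≤ ∫⁻ p, ((∫⁻ τ, a τ) ^ 3 * ∫⁻ τ, u τ p ^ 4 * (a τ ^ 3)⁻¹) ∂μ := lintegral_mono h1
    _ = (∫⁻ τ, a τ) ^ 3 * ∫⁻ τ, (∫⁻ p, u τ p ^ 4 * (a τ ^ 3)⁻¹ ∂μ) := by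
        rw [lintegral_const_mul _ (show Measurable (fun p => ∫⁻ τ, u τ p ^ 4 * (a τ ^ 3)⁻¹) from
          hm.lintegral_prod_right'), lintegral_lintegral_swap hm.aemeasurable]
    _ ≤ (∫⁻ τ, a τ) ^ 3 * ∫⁻ τ, K * a τ := by
        gcongr with τ
        have hup : Measurable (fun p => u τ p) := hu.comp (measurable_const.prodMk measurable_id)
        rw [lintegral_mul_const _ (hup.pow_const 4)]
        calc _ ≤ K * a τ ^ 4 * (a τ ^ 3)⁻¹ := by gcongr; exact hK τ
          _ = K * a τ * (a τ ^ 3 * (a τ ^ 3)⁻¹) := by ring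
          _ ≤ K * a τ * 1 := by gcongr; exact ENNReal.mul_inv_le_one _
          _ = _ := mul_one _
    _ = _ := by rw [lintegral_const_mul _ ha]; ring

lemma lint_ofReal (φ : ℝ → ℝ) (hφ : Continuous φ) (h0 : ∀ x, 0 ≤ φ x) (a b : ℝ) (hab : a ≤ b) :
    ∫⁻ x in Set.Ioc a b, ENNReal.ofReal (φ x) = ENNReal.ofReal (∫ x in a..b, φ x) := by
  rw [intervalIntegral.integral_of_le hab, ofReal_integral_eq_lintegral_ofReal]
  · exact (hφ.integrableOn_Icc).mono_set Set.Ioc_subset_Icc_self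
  · exact Filter.Eventually.of_forall h0

lemma enn_prod (F : ℝ → ℝ → ℂ) (hc : Continuous (fun p : ℝ × ℝ => F p.2 p.1)) (r : ℝ) (hr : 0 < r) :
    ∫⁻ p, ‖F p.2 p.1‖ₑ ^ 4 ∂((volume.restrict (Set.Ioc (-r) r)).prod
        (volume.restrict (Set.Ioc (0:ℝ) 1)))
      = ENNReal.ofReal (∫ t in (-r)..r, ∫ x in (0:ℝ)..1, ‖F x t‖ ^ 4) := by
  have hc4 : Continuous (fun p : ℝ × ℝ => ‖F p.2 p.1‖ ^ 4) := hc.norm.pow 4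
  have e : ∀ p : ℝ × ℝ, ‖F p.2 p.1‖ₑ ^ 4 = ENNReal.ofReal (‖F p.2 p.1‖ ^ 4) := by
    intro p
    rw [ENNReal.ofReal_pow (norm_nonneg _), ofReal_norm]
  rw [lintegral_congr e, lintegral_prod _ hc4.measurable.ennreal_ofReal.aemeasurable]
  have hct : ∀ t : ℝ, Continuous (fun x : ℝ => ‖F x t‖ ^ 4) := fun t =>
    hc4.comp (Continuous.prodMk continuous_const continuous_id)
  have e1 : ∀ t : ℝ, ∫⁻ x in Set.Ioc (0:ℝ) 1, ENNReal.ofReal (‖F x t‖ ^ 4)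
      = ENNReal.ofReal (∫ x in (0:ℝ)..1, ‖F x t‖ ^ 4) := fun t =>
    lint_ofReal (fun x => ‖F x t‖ ^ 4) (hct t) (fun x => pow_nonneg (norm_nonneg _) 4) 0 1 zero_le_one
  have hI : Continuous (fun t : ℝ => ∫ x in (0:ℝ)..1, ‖F x t‖ ^ 4) :=
    intervalIntegral.continuous_parametric_intervalIntegral_of_continuous' hc4 0 1
  have hI0 : ∀ t : ℝ, 0 ≤ ∫ x in (0:ℝ)..1, ‖F x t‖ ^ 4 := fun t =>
    intervalIntegral.integral_nonneg zero_le_one (fun x _ => pow_nonneg (norm_nonneg _) 4)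
  rw [← lint_ofReal _ hI hI0 _ _ (by linarith)]
  exact lintegral_congr e1

lemma fw_cont (N : ℕ) (g : ℤ → ℂ) : Continuous (fun p : ℝ × ℝ => fw N g p.2 p.1) := by
  unfold fw; fun_prop

lemma sqrt_four (G : ℝ) (hG0 : 0 ≤ G) : Real.sqrt G ^ 4 = G ^ 2 := by
  calc Real.sqrt G ^ 4 = (Real.sqrt G ^ 2) ^ 2 := by ring
    _ = _ := by rw [Real.sq_sqrt hG0]

lemma free_enn (N : ℕ) (g : ℤ → ℂ) (hg : ∀ k ∉ Finset.Icc (-(N:ℤ)) N, g k = 0) (R δ : ℝ) (hR : 0 < R)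
    (hδ : 0 < δ) (hδ1 : δ < 1) :
    ∫⁻ p, ‖fw N g p.2 p.1‖ₑ ^ 4 ∂((volume.restrict (Set.Ioc (-(R * δ)) (R * δ))).prod
        (volume.restrict (Set.Ioc (0:ℝ) 1)))
      ≤ ENNReal.ofReal ((12 * R + 1) * δ ^ (1/2 : ℝ)) *
        ENNReal.ofReal (Real.sqrt (∑ l ∈ Finset.Icc (-(N:ℤ)) N, ‖g l‖ ^ 2)) ^ 4 := by
  rw [enn_prod (fw N g) (fw_cont N g) (R * δ) (mul_pos hR hδ)]
  have hG0 : 0 ≤ ∑ l ∈ Finset.Icc (-(N:ℤ)) N, ‖g l‖ ^ 2 := Finset.sum_nonneg fun _ _ => sq_nonneg _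
  have hp : 0 ≤ (12 * R + 1) * δ ^ (1/2 : ℝ) := by positivity
  rw [← ENNReal.ofReal_pow (Real.sqrt_nonneg _), ← ENNReal.ofReal_mul hp, sqrt_four _ hG0]
  exact ENNReal.ofReal_le_ofReal (free N g hg R δ hR hδ hδ1)

lemma cs_weight (b : ℝ) (a : ℝ → ENNReal) (ha : Measurable a) :
    (∫⁻ τ, a τ) ^ 2 ≤ (∫⁻ τ : ℝ, ENNReal.ofReal ((1 + ‖τ‖) ^ (-(2 * b)))) *
      ∫⁻ τ, ENNReal.ofReal ((1 + |τ|) ^ (2 * b)) * a τ ^ 2 := by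
  have hH := ENNReal.lintegral_mul_le_Lp_mul_Lq volume Real.HolderConjugate.two_two
      (f := fun τ : ℝ => ENNReal.ofReal ((1 + ‖τ‖) ^ (-b)))
      (g := fun τ : ℝ => ENNReal.ofReal ((1 + |τ|) ^ b) * a τ)
      (by fun_prop) (by fun_prop)
  have e1 : ∀ τ : ℝ, ((fun τ : ℝ => ENNReal.ofReal ((1 + ‖τ‖) ^ (-b))) *
      (fun τ : ℝ => ENNReal.ofReal ((1 + |τ|) ^ b) * a τ)) τ = a τ := by
    intro τ
    have : (0:ℝ) < 1 + |τ| := by positivity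
    simp only [Pi.mul_apply, Real.norm_eq_abs]
    rw [← mul_assoc, ← ENNReal.ofReal_mul (by positivity), ← Real.rpow_add this]
    simp
  have e2 : ∀ τ : ℝ, ENNReal.ofReal ((1 + ‖τ‖) ^ (-b)) ^ (2:ℝ) = ENNReal.ofReal ((1 + ‖τ‖) ^ (-(2 * b))) := by
    intro τ
    rw [ENNReal.ofReal_rpow_of_nonneg (by positivity) (by norm_num), ← Real.rpow_mul (by positivity)]
    congr 2; ring
  have e3 : ∀ τ : ℝ, (ENNReal.ofReal ((1 + |τ|) ^ b) * a τ) ^ (2:ℝ)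
      = ENNReal.ofReal ((1 + |τ|) ^ (2 * b)) * a τ ^ 2 := by
    intro τ
    rw [ENNReal.mul_rpow_of_nonneg _ _ (by norm_num),
      ENNReal.ofReal_rpow_of_nonneg (by positivity) (by norm_num), ← Real.rpow_mul (by positivity),
      ← ENNReal.rpow_natCast]
    congr 3; ring
  simp only [e1, e2, e3] at hH
  calc _ ≤ _ := pow_le_pow_left₀ (by simp) hH 2
    _ = _ := by
      rw [mul_pow, ← ENNReal.rpow_natCast, ← ENNReal.rpow_natCast, ← ENNReal.rpow_mul, ← ENNReal.rpow_mul]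
      norm_num

/-- The squared X norm -/
noncomputable def X2 (b : ℝ) (f : ℝ → ℝ → ℂ) : ENNReal :=
  ∑' k : ℤ, ∫⁻ η : ℝ, ENNReal.ofReal ((1 + |η + 2 * Real.pi * (k : ℝ) ^ 2|) ^ (2 * b) * ‖stFT f k η‖ ^ 2)

lemma XNorm_eq (b : ℝ) (f : ℝ → ℝ → ℂ) : XNorm 0 b f = X2 b f ^ ((1:ℝ)/2) := by
  unfold XNorm X2
  simp

lemma shift_int (b : ℝ) (f : ℝ → ℝ → ℂ) (k : ℤ) :
    ∫⁻ τ : ℝ, ENNReal.ofReal ((1 + |τ|) ^ (2 * b)) * ENNReal.ofReal (‖stFT f k (τ - 2 * Real.pi * k ^ 2)‖ ^ 2)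
      = ∫⁻ η : ℝ, ENNReal.ofReal ((1 + |η + 2 * Real.pi * (k : ℝ) ^ 2|) ^ (2 * b) * ‖stFT f k η‖ ^ 2) := by
  rw [← lintegral_sub_right_eq_self (fun η : ℝ => ENNReal.ofReal
    ((1 + |η + 2 * Real.pi * (k : ℝ) ^ 2|) ^ (2 * b) * ‖stFT f k η‖ ^ 2)) (2 * Real.pi * (k:ℝ) ^ 2)]
  refine lintegral_congr fun τ => ?_
  rw [sub_add_cancel, ENNReal.ofReal_mul (by positivity)]

lemma J_lt (b : ℝ) (hb : 1/2 < b) : (∫⁻ τ : ℝ, ENNReal.ofReal ((1 + ‖τ‖) ^ (-(2 * b)))) < ⊤ :=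
  finite_integral_one_add_norm (by simp; linarith)

lemma stFT_integrable (b : ℝ) (hb : 1/2 < b) (f : ℝ → ℝ → ℂ) (hf : SmoothCptTime f)
    (hX : X2 b f ≠ ⊤) (k : ℤ) : Integrable (stFT f k) := by
  refine ⟨(stFT_cont f hf k).aestronglyMeasurable, ?_⟩
  rw [hasFiniteIntegral_def]
  have hc := stFT_cont f hf k
  have h := cs_weight b (fun τ => ‖stFT f k (τ - 2 * Real.pi * k ^ 2)‖ₑ)
    (Continuous.measurable (by fun_prop))
  have e : ∀ τ : ℝ, ‖stFT f k (τ - 2 * Real.pi * k ^ 2)‖ₑ ^ 2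
    = ENNReal.ofReal (‖stFT f k (τ - 2 * Real.pi * k ^ 2)‖ ^ 2) := by
    intro τ
    rw [ENNReal.ofReal_pow (norm_nonneg _), ofReal_norm]
  simp_rw [e] at h
  rw [shift_int] at h
  rw [lintegral_sub_right_eq_self (fun η => ‖stFT f k η‖ₑ)] at h
  have h2 : (∫⁻ η, ‖stFT f k η‖ₑ) ^ 2 < ⊤ := by
    refine h.trans_lt (ENNReal.mul_lt_top (J_lt b hb) ?_)
    refine lt_of_le_of_lt ?_ hX.lt_top
    exact ENNReal.le_tsum (f := fun k : ℤ => ∫⁻ η : ℝ, ENNReal.ofReal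
      ((1 + |η + 2 * Real.pi * (k : ℝ) ^ 2|) ^ (2 * b) * ‖stFT f k η‖ ^ 2)) k
  exact (ENNReal.pow_lt_top_iff.1 h2).resolve_right (by norm_num)

/-- shifted truncated coefficients -/
noncomputable def gk (f : ℝ → ℝ → ℂ) (N : ℕ) (τ : ℝ) (k : ℤ) : ℂ :=
  if k ∈ Finset.Icc (-(N:ℤ)) N then stFT f k (τ - 2 * Real.pi * k ^ 2) else 0

/-- truncated Fourier series -/
noncomputable def fN (f : ℝ → ℝ → ℂ) (N : ℕ) (x t : ℝ) : ℂ :=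
  ∑ k ∈ Finset.Icc (-(N:ℤ)) N, cc (fun x => f x t) k * ex (k * x)

lemma gk_cont (f : ℝ → ℝ → ℂ) (hf : SmoothCptTime f) (N : ℕ) (k : ℤ) :
    Continuous (fun τ => gk f N τ k) := by
  unfold gk
  have hc := stFT_cont f hf k
  split_ifs
  · fun_prop
  · exact continuous_const

lemma fN_eq (b : ℝ) (hb : 1/2 < b) (f : ℝ → ℝ → ℂ) (hf : SmoothCptTime f)
    (hX : X2 b f ≠ ⊤) (N : ℕ) (x t : ℝ) :
    fN f N x t = ∫ τ : ℝ, ex (τ * t) * fw N (gk f N τ) x t := by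
  unfold fN fw
  simp_rw [Finset.mul_sum]
  have key : ∀ k ∈ Finset.Icc (-(N:ℤ)) N, ∀ τ : ℝ,
      ex (τ * t) * (gk f N τ k * ex (k * x - 2 * Real.pi * k ^ 2 * t))
      = (stFT f k (τ - 2 * Real.pi * k ^ 2) * ex ((τ - 2 * Real.pi * k ^ 2) * t)) * ex (k * x) := by
    intro k hk τ
    unfold gk
    have h : ex (τ * t) * ex (k * x - 2 * Real.pi * k ^ 2 * t)
        = ex ((τ - 2 * Real.pi * k ^ 2) * t) * ex (k * x) := by
      rw [← ex_add, ← ex_add]; congr 1; ring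
    rw [if_pos hk]
    linear_combination stFT f k (τ - 2 * Real.pi * k ^ 2) * h
  have hintg : ∀ k, Integrable (fun η => stFT f k η * ex (η * t)) := by
    intro k
    refine (stFT_integrable b hb f hf hX k).mono ?_ ?_
    · have hc := stFT_cont f hf k
      exact Continuous.aestronglyMeasurable (by fun_prop)
    · exact Filter.Eventually.of_forall fun η => by simp [norm_ex]
  rw [integral_finsetSum]
  · refine Finset.sum_congr rfl fun k hk => ?_
    simp_rw [key k hk]
    rw [integral_mul_const, integral_sub_right_eq_self (fun η => stFT f k η * ex (η * t)),
      ← stFT_inv f hf k (stFT_integrable b hb f hf hX k)]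
  · intro k hk
    simp_rw [key k hk]
    exact ((hintg k).comp_sub_right (2 * Real.pi * (k:ℝ) ^ 2)).mul_const _

lemma fN_bound (b : ℝ) (hb : 1/2 < b) (f : ℝ → ℝ → ℂ) (hf : SmoothCptTime f)
    (hX : X2 b f ≠ ⊤) (N : ℕ) (R δ : ℝ) (hR : 0 < R) (hδ : 0 < δ) (hδ1 : δ < 1) :
    ∫⁻ p, ‖fN f N p.2 p.1‖ₑ ^ 4 ∂((volume.restrict (Set.Ioc (-(R * δ)) (R * δ))).prod
        (volume.restrict (Set.Ioc (0:ℝ) 1)))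
      ≤ ENNReal.ofReal ((12 * R + 1) * δ ^ (1/2 : ℝ)) *
        ((∫⁻ τ : ℝ, ENNReal.ofReal ((1 + ‖τ‖) ^ (-(2 * b)))) * X2 b f) ^ 2 := by
  set μ := (volume.restrict (Set.Ioc (-(R * δ)) (R * δ))).prod (volume.restrict (Set.Ioc (0:ℝ) 1)) with hμ
  set a : ℝ → ENNReal := fun τ => ENNReal.ofReal (Real.sqrt (∑ l ∈ Finset.Icc (-(N:ℤ)) N, ‖gk f N τ l‖ ^ 2)) with ha
  have hg := gk_cont f hf N
  have ham : Measurable a := by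
    apply Measurable.ennreal_ofReal
    apply Continuous.measurable
    fun_prop
  have hcont : Continuous (fun q : ℝ × (ℝ × ℝ) => fw N (gk f N q.1) q.2.2 q.2.1) := by
    unfold fw
    refine continuous_finsetSum _ fun k _ => ?_
    have h1 : Continuous (fun q : ℝ × (ℝ × ℝ) => gk f N q.1 k) := (hg k).comp continuous_fst
    fun_prop
  have hm := mink μ (fun τ p => ‖fw N (gk f N τ) p.2 p.1‖ₑ) a
    (by simpa only [Function.uncurry_def] using hcont.enorm.measurable)
    ham (fun _ => ENNReal.ofReal_ne_top) (by
      intro τ p h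
      simp only [ha, ENNReal.ofReal_eq_zero] at h
      have h2 := Real.sqrt_eq_zero'.1 (le_antisymm h (Real.sqrt_nonneg _))
      have h3 := (Finset.sum_eq_zero_iff_of_nonneg (fun _ _ => by positivity)).1
        (le_antisymm h2 (Finset.sum_nonneg fun _ _ => by positivity))
      rw [enorm_eq_zero]
      unfold fw
      refine Finset.sum_eq_zero fun k hk => ?_
      have := h3 k hk
      have h4 : gk f N τ k = 0 := by simpa using this
      rw [h4, zero_mul]) (ENNReal.ofReal ((12 * R + 1) * δ ^ (1/2 : ℝ)))
    (fun τ => free_enn N (gk f N τ) (fun k hk => if_neg hk) R δ hR hδ hδ1)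
  have hA : (∫⁻ τ, a τ) ^ 2 ≤ (∫⁻ τ : ℝ, ENNReal.ofReal ((1 + ‖τ‖) ^ (-(2 * b)))) * X2 b f := by
    refine (cs_weight b a ham).trans ?_
    gcongr
    have e : ∀ τ, ENNReal.ofReal ((1 + |τ|) ^ (2 * b)) * a τ ^ 2 = ∑ k ∈ Finset.Icc (-(N:ℤ)) N,
        ENNReal.ofReal ((1 + |τ|) ^ (2 * b)) * ENNReal.ofReal (‖stFT f k (τ - 2 * Real.pi * k ^ 2)‖ ^ 2) := by
      intro τ
      simp only [ha]
      rw [← ENNReal.ofReal_pow (Real.sqrt_nonneg _), Real.sq_sqrt (by positivity),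
        ENNReal.ofReal_sum_of_nonneg (fun _ _ => by positivity), Finset.mul_sum]
      refine Finset.sum_congr rfl fun k hk => ?_
      unfold gk
      rw [if_pos hk]
    simp_rw [e]
    rw [lintegral_finsetSum]
    · simp_rw [shift_int]
      exact ENNReal.sum_le_tsum _
    · intro k _
      have hc := stFT_cont f hf k
      refine Measurable.mul (f := fun τ : ℝ => ENNReal.ofReal ((1 + |τ|) ^ (2 * b))) ?_ ?_
      · fun_prop
      · exact Measurable.ennreal_ofReal (Continuous.measurable (by fun_prop))
  calc _ ≤ ∫⁻ p, (∫⁻ τ, ‖fw N (gk f N τ) p.2 p.1‖ₑ) ^ 4 ∂μ := by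
        refine lintegral_mono fun p => ?_
        refine pow_le_pow_left₀ (by simp) ?_ 4
        rw [fN_eq b hb f hf hX]
        refine (enorm_integral_le_lintegral_enorm _).trans (le_of_eq ?_)
        refine lintegral_congr fun τ => ?_
        rw [enorm_mul, ← ofReal_norm (ex _), norm_ex]; simp
    _ ≤ _ := hm
    _ = ENNReal.ofReal ((12 * R + 1) * δ ^ (1/2 : ℝ)) * ((∫⁻ τ, a τ) ^ 2) ^ 2 := by ring
    _ ≤ _ := by gcongr

lemma fN_tendsto (f : ℝ → ℝ → ℂ) (hf : SmoothCptTime f) (x t : ℝ) :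
    Filter.Tendsto (fun N => fN f N x t) Filter.atTop (nhds (f x t)) := by
  have h1 : ContDiff ℝ 2 (fun x => f x t) := by
    have : ContDiff ℝ (⊤ : ℕ∞) (fun x => f x t) := hf.1.comp (by fun_prop : ContDiff ℝ _ fun x : ℝ => (x, t))
    exact this.of_le (by exact WithTop.coe_le_coe.2 (le_top : (2 : ℕ∞) ≤ ⊤))
  have := cc_hasSum (fun x => f x t) h1 (fun x => hf.2.1 x t) x
  rw [HasSum, SummationFilter.unconditional_filter] at this
  refine this.comp ?_
  apply Filter.tendsto_atTop_finset_of_monotone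
  · intro m n h
    exact Finset.Icc_subset_Icc (by omega) (by omega)
  · intro k
    exact ⟨k.natAbs, by rw [Finset.mem_Icc]; omega⟩

lemma f_bound (b : ℝ) (hb : 1/2 < b) (f : ℝ → ℝ → ℂ) (hf : SmoothCptTime f)
    (hX : X2 b f ≠ ⊤) (R δ : ℝ) (hR : 0 < R) (hδ : 0 < δ) (hδ1 : δ < 1) :
    ∫⁻ t in Set.Ioc (-(R * δ)) (R * δ), ∫⁻ x in Set.Ioc (0:ℝ) 1, ‖f x t‖ₑ ^ 4
      ≤ ENNReal.ofReal ((12 * R + 1) * δ ^ (1/2 : ℝ)) *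
        ((∫⁻ τ : ℝ, ENNReal.ofReal ((1 + ‖τ‖) ^ (-(2 * b)))) * X2 b f) ^ 2 := by
  have h : Continuous (fun p : ℝ × ℝ => f p.1 p.2) := hf.1.continuous
  have h2 : Continuous (fun p : ℝ × ℝ => f p.2 p.1) := h.comp continuous_swap
  have e := lintegral_prod (μ := volume.restrict (Set.Ioc (-(R * δ)) (R * δ)))
    (ν := volume.restrict (Set.Ioc (0:ℝ) 1)) (fun p : ℝ × ℝ => ‖f p.2 p.1‖ₑ ^ 4)
    (h2.enorm.measurable.pow_const 4).aemeasurable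
  simp only at e
  rw [← e]
  have hm : ∀ N, Measurable (fun p : ℝ × ℝ => ‖fN f N p.2 p.1‖ₑ ^ 4) := by
    intro N
    apply Measurable.pow_const
    apply Measurable.enorm
    unfold fN
    refine Continuous.measurable (continuous_finsetSum _ fun k _ => ?_)
    have := (cc_cont f hf k).comp (continuous_fst (X := ℝ) (Y := ℝ))
    exact this.mul (by fun_prop)
  have hl : ∀ p : ℝ × ℝ, ‖f p.2 p.1‖ₑ ^ 4 = Filter.liminf (fun N => ‖fN f N p.2 p.1‖ₑ ^ 4) Filter.atTop := by
    intro p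
    refine (Filter.Tendsto.liminf_eq ?_).symm
    exact (ENNReal.continuous_pow 4).continuousAt.tendsto.comp (fN_tendsto f hf p.2 p.1).enorm
  simp_rw [hl]
  refine (lintegral_liminf_le hm).trans ?_
  refine Filter.liminf_le_of_frequently_le' (Filter.Frequently.of_forall fun N => ?_)
  exact fN_bound b hb f hf hX N R δ hR hδ hδ1

/-- **Time-localized `L⁴` Strichartz bound with a gain.** Let `b ∈ (1/2,1)`,
`θ = (b-3/8)/b`, `θ₀ = θ/4 + (1-θ)(1-2b)/2 > 0`, and `ψ ∈ C_c^∞(ℝ)`. There is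
`C = C(b,ψ)` such that for every `δ ∈ (0,1)` and every smooth `f` compactly supported in
time, `‖ψ(t/δ) f‖_{L⁴(𝕋×ℝ)} ≤ C δ^{θ₀} ‖f‖_{X^{0,b}}`. -/
theorem L4_time_localized_strichartz (b θ θ₀ : ℝ) (hb : b ∈ Set.Ioo (1/2 : ℝ) 1)
    (hθ : θ = (b - 3/8) / b) (hθ₀ : θ₀ = θ/4 + (1 - θ) * (1 - 2*b) / 2) (hpos : 0 < θ₀)
    (ψ : ℝ → ℂ) (hψ : ContDiff ℝ (⊤ : ℕ∞) ψ) (hψc : HasCompactSupport ψ) :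
    ∃ C : ℝ, 0 < C ∧ ∀ δ : ℝ, δ ∈ Set.Ioo (0:ℝ) 1 → ∀ f : ℝ → ℝ → ℂ, SmoothCptTime f →
      L4Norm (fun x t => ψ (t / δ) * f x t)
        ≤ ENNReal.ofReal (C * δ ^ θ₀) * XNorm 0 b f := by
  obtain ⟨hb1, hb2⟩ := hb
  have hb0 : 0 < b := by linarith
  have hle : θ₀ ≤ 1/8 := by
    have h1 : θ₀ = -(1/8) + 3 / (32 * b) := by
      rw [hθ₀, hθ]; field_simp; ring
    have h2 : 3 / (32 * b) ≤ 1/4 := by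
      rw [div_le_iff₀ (by positivity)]; linarith
    linarith
  obtain ⟨B, hB⟩ := hψ.continuous.bounded_above_of_compact_support hψc
  obtain ⟨R, hR, hRs⟩ : ∃ R : ℝ, 0 < R ∧ ∀ t, R ≤ |t| → ψ t = 0 := by
    obtain ⟨r, hr⟩ := hψc.isCompact.isBounded.subset_closedBall 0
    refine ⟨|r| + 1, by positivity, fun t ht => ?_⟩
    by_contra hne
    have := hr (subset_tsupport _ (Function.mem_support.2 hne))
    rw [mem_closedBall_zero_iff, Real.norm_eq_abs] at this
    linarith [le_abs_self r]
  have hB0 : 0 ≤ B := (norm_nonneg _).trans (hB 0)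
  set J := ∫⁻ τ : ℝ, ENNReal.ofReal ((1 + ‖τ‖) ^ (-(2 * b))) with hJ
  have hJt : J ≠ ⊤ := (J_lt b hb1).ne
  set E : ℝ := B ^ 4 * (12 * R + 1) with hE
  have hE0 : 0 ≤ E := by positivity
  refine ⟨E ^ (1/4 : ℝ) * J.toReal ^ (1/2 : ℝ) + 1, by positivity, fun δ hδ f hf => ?_⟩
  obtain ⟨hδ0, hδ1⟩ := hδ
  rw [XNorm_eq]
  by_cases hX : X2 b f = ⊤
  · rw [hX, ENNReal.top_rpow_of_pos (by norm_num), ENNReal.mul_top]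
    · exact le_top
    · rw [Ne, ENNReal.ofReal_eq_zero, not_le]; positivity
  have h1 : ∫⁻ t : ℝ, ∫⁻ x in Set.Ioc (0:ℝ) 1, ENNReal.ofReal (‖ψ (t / δ) * f x t‖ ^ 4)
      ≤ ENNReal.ofReal (E * δ ^ (1/2 : ℝ)) * (J * X2 b f) ^ 2 := by
    calc _ ≤ ∫⁻ t : ℝ, (Set.Ioc (-(R * δ)) (R * δ)).indicator
          (fun t => ENNReal.ofReal (B ^ 4) * ∫⁻ x in Set.Ioc (0:ℝ) 1, ‖f x t‖ₑ ^ 4) t := by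
          refine lintegral_mono fun t => ?_
          by_cases ht : t ∈ Set.Ioc (-(R * δ)) (R * δ)
          · rw [Set.indicator_of_mem ht, ← lintegral_const_mul' _ _ ENNReal.ofReal_ne_top]
            refine lintegral_mono fun x => ?_
            rw [← ofReal_norm, ← ENNReal.ofReal_pow (norm_nonneg _), ← ENNReal.ofReal_mul (by positivity),
              norm_mul, mul_pow]
            apply ENNReal.ofReal_le_ofReal
            have := hB (t / δ)
            gcongr
          · rw [Set.indicator_of_notMem ht]
            have : ψ (t / δ) = 0 := by
              apply hRs
              rw [abs_div, abs_of_pos hδ0, le_div_iff₀ hδ0]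
              by_contra h
              push Not at h
              exact ht ⟨(abs_lt.1 h).1, (abs_lt.1 h).2.le⟩
            simp [this]
      _ = ENNReal.ofReal (B ^ 4) * ∫⁻ t in Set.Ioc (-(R * δ)) (R * δ), ∫⁻ x in Set.Ioc (0:ℝ) 1, ‖f x t‖ₑ ^ 4 := by
          rw [lintegral_indicator measurableSet_Ioc, lintegral_const_mul' _ _ ENNReal.ofReal_ne_top]
      _ ≤ ENNReal.ofReal (B ^ 4) * (ENNReal.ofReal ((12 * R + 1) * δ ^ (1/2 : ℝ)) * (J * X2 b f) ^ 2) := by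
          gcongr
          exact f_bound b hb1 f hf hX R δ hR hδ0 hδ1
      _ = _ := by
          rw [← mul_assoc, ← ENNReal.ofReal_mul (by positivity), hE, mul_assoc (B ^ 4)]
  unfold L4Norm
  calc _ ≤ (ENNReal.ofReal (E * δ ^ (1/2 : ℝ)) * (J * X2 b f) ^ 2) ^ ((1:ℝ)/4) := by gcongr
    _ = ENNReal.ofReal (E ^ (1/4 : ℝ) * δ ^ (1/8 : ℝ) * J.toReal ^ (1/2 : ℝ)) * X2 b f ^ ((1:ℝ)/2) := by
        rw [ENNReal.mul_rpow_of_nonneg _ _ (by norm_num), ENNReal.ofReal_rpow_of_nonneg (by positivity) (by norm_num),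
          Real.mul_rpow hE0 (by positivity), ← Real.rpow_mul hδ0.le, ← ENNReal.rpow_natCast, ← ENNReal.rpow_mul,
          ENNReal.mul_rpow_of_nonneg _ _ (by norm_num), ← mul_assoc]
        rw [ENNReal.ofReal_mul (p := E ^ (1/4 : ℝ) * δ ^ (1/8 : ℝ)) (by positivity),
          ← ENNReal.ofReal_rpow_of_nonneg (ENNReal.toReal_nonneg) (by norm_num), ENNReal.ofReal_toReal hJt]
        norm_num
    _ ≤ _ := by
        refine mul_le_mul_left (ENNReal.ofReal_le_ofReal ?_) _
        have : δ ^ (1/8 : ℝ) ≤ δ ^ θ₀ := Real.rpow_le_rpow_of_exponent_ge hδ0 hδ1.le hle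
        have h0 : 0 ≤ E ^ (1/4 : ℝ) * J.toReal ^ (1/2 : ℝ) := by positivity
        have h3 : 0 ≤ δ ^ θ₀ := by positivity
        nlinarith [mul_le_mul_of_nonneg_left this h0]
end

section
/- Let b' > 1/4. There exists a constant C = C(b') such that for every f : 𝕋 × ℝ → ℂ smooth and compactly supported in the time variable, ( ∫_ℝ ‖f(·,t)‖_{L²(𝕋)}⁴ dt )^{1/4} ≤ C ‖f‖_{X^{0,b'}}. -/
open MeasureTheory

namespace XEmb

open scoped FourierTransform ContDiff ENNReal
open MeasureTheory

lemma cs {α : Type*} [MeasurableSpace α] (μ : Measure α) {f g : α → ℝ≥0∞}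
    (hf : AEMeasurable f μ) (hg : AEMeasurable g μ) :
    (∫⁻ a, f a * g a ∂μ) ^ 2 ≤ (∫⁻ a, f a ^ 2 ∂μ) * (∫⁻ a, g a ^ 2 ∂μ) := by
  have h := ENNReal.lintegral_mul_le_Lp_mul_Lq μ Real.HolderConjugate.two_two hf hg
  simp only [Pi.mul_apply, ENNReal.rpow_two] at h
  calc _ ≤ _ := pow_le_pow_left' h 2
    _ = _ := by
      rw [mul_pow, ← ENNReal.rpow_natCast, ← ENNReal.rpow_natCast, ← ENNReal.rpow_mul,
        ← ENNReal.rpow_mul]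
      norm_num

lemma lintegral_sq_fourier (P : SchwartzMap ℝ ℂ) :
    ∫⁻ x, ‖𝓕 P x‖ₑ ^ 2 = ∫⁻ x, ‖P x‖ₑ ^ 2 := by
  have key : ∀ Q : SchwartzMap ℝ ℂ, ∫⁻ x, ‖Q x‖ₑ ^ 2 = ENNReal.ofReal (∫ x, ‖Q x‖ ^ 2) := by
    intro Q
    rw [ofReal_integral_eq_lintegral_ofReal]
    · refine lintegral_congr fun x => ?_
      rw [ENNReal.ofReal_pow (norm_nonneg _), ofReal_norm]
    · exact (Q.memLp 2).integrable_norm_pow (by norm_num)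
    · exact Filter.Eventually.of_forall fun x => by positivity
  rw [key, key, SchwartzMap.integral_norm_sq_fourier]

lemma l4_eq (g : SchwartzMap ℝ ℂ) :
    ∫⁻ x, ‖g x‖ₑ ^ 4 ≤
      ∫⁻ ξ, (∫⁻ η, ‖𝓕 g η‖ₑ * ‖𝓕 g (ξ - η)‖ₑ) ^ 2 := by
  set h := 𝓕 g with hh
  set P := SchwartzMap.convolution (ContinuousLinearMap.mul ℂ ℂ) h h with hP
  have h1 := lintegral_sq_fourier P
  have h2 : ∀ x, 𝓕 P x = g (-x) * g (-x) := by
    intro x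
    have h3 : 𝓕 h x = g (-x) := by
      have : 𝓕⁻ h (-x) = g (-x) := by rw [hh]; simp
      rw [← this, SchwartzMap.fourierInv_coe, Real.fourierInv_eq_fourier_neg, neg_neg]
      rfl
    rw [hP, SchwartzMap.fourier_convolution, SchwartzMap.pairing_apply_apply, h3]
    rfl
  have h3 : ∫⁻ x, ‖g x‖ₑ ^ 4 = ∫⁻ x, ‖𝓕 P x‖ₑ ^ 2 := by
    rw [← lintegral_neg_eq_self (μ := volume) (fun x => ‖g x‖ₑ ^ 4)]
    refine lintegral_congr fun x => ?_
    rw [h2, enorm_mul]; ring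
  rw [h3, h1]
  refine lintegral_mono fun ξ => ?_
  gcongr
  rw [hP, SchwartzMap.convolution_apply]
  refine (enorm_integral_le_lintegral_enorm _).trans_eq ?_
  simp

lemma young (H W V : ℝ → ℝ≥0∞) (hH : Measurable H) (hW : Measurable W) (hV : Measurable V)
    (hWV : ∀ x, W x * V x = 1) (A : ℝ≥0∞) (hA : ∫⁻ x, V x ^ 4 = A) :
    ∫⁻ ξ, (∫⁻ η, H η * H (ξ - η)) ^ 2 ≤ A * (∫⁻ η, (W η * H η) ^ 2) ^ 2 := by
  have hpt : ∀ ξ, (∫⁻ η, H η * H (ξ - η)) ^ 2 ≤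
      A * ∫⁻ η, (W η * H η) ^ 2 * (W (ξ - η) * H (ξ - η)) ^ 2 := by
    intro ξ
    have e1 : ∀ η, H η * H (ξ - η) =
        (V η * V (ξ - η)) * ((W η * H η) * (W (ξ - η) * H (ξ - η))) := by
      intro η
      calc _ = (W η * V η) * (W (ξ - η) * V (ξ - η)) * (H η * H (ξ - η)) := by
            rw [hWV, hWV]; simp
        _ = _ := by ring
    simp_rw [e1]
    refine (cs volume (by fun_prop) (by fun_prop)).trans ?_
    simp_rw [mul_pow (W _ * H _) (W (_ - _) * H _)]
    gcongr
    have h4 := cs (volume : Measure ℝ) (f := fun η => V η ^ 2) (g := fun η => V (ξ - η) ^ 2)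
      (by fun_prop) (by fun_prop)
    simp_rw [← pow_mul] at h4
    norm_num at h4
    rw [lintegral_sub_left_eq_self (μ := volume) (fun x => V x ^ 4) ξ, hA, ← sq] at h4
    simp_rw [mul_pow]
    exact (ENNReal.pow_le_pow_left_iff (by norm_num)).1 h4
  calc _ ≤ ∫⁻ ξ, A * ∫⁻ η, (W η * H η) ^ 2 * (W (ξ - η) * H (ξ - η)) ^ 2 := lintegral_mono hpt
    _ = A * ∫⁻ ξ, ∫⁻ η, (W η * H η) ^ 2 * (W (ξ - η) * H (ξ - η)) ^ 2 := by
      rw [lintegral_const_mul]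
      exact Measurable.lintegral_prod_right' (f := fun p : ℝ × ℝ =>
        (W p.2 * H p.2) ^ 2 * (W (p.1 - p.2) * H (p.1 - p.2)) ^ 2) (by fun_prop)
    _ = A * ∫⁻ η, ∫⁻ ξ, (W η * H η) ^ 2 * (W (ξ - η) * H (ξ - η)) ^ 2 := by
      rw [lintegral_lintegral_swap]
      exact Measurable.aemeasurable (by unfold Function.uncurry; fun_prop)
    _ = _ := by
      congr 1
      rw [sq (∫⁻ η, _), ← lintegral_mul_const _ (by fun_prop)]
      refine lintegral_congr fun η => ?_
      rw [lintegral_const_mul _ (by fun_prop),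
        lintegral_sub_right_eq_self (μ := volume) (fun x => (W x * H x) ^ 2) η]

lemma l4_bound (b a : ℝ) (g : SchwartzMap ℝ ℂ) :
    ∫⁻ x, ‖g x‖ₑ ^ 4 ≤ (∫⁻ x : ℝ, ENNReal.ofReal ((1 + ‖x‖) ^ (-(4 * b)))) *
      (∫⁻ η, ENNReal.ofReal ((1 + |η + a|) ^ (2 * b) * ‖𝓕 g η‖ ^ 2)) ^ 2 := by
  refine (l4_eq g).trans ?_
  have pos : ∀ x : ℝ, 0 < 1 + |x| := fun x => by positivity
  refine (young (fun η => ‖𝓕 g η‖ₑ) (fun η => ENNReal.ofReal ((1 + |η + a|) ^ b))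
    (fun η => ENNReal.ofReal ((1 + |η + a|) ^ (-b))) ?_ ?_ ?_ ?_
    (∫⁻ x : ℝ, ENNReal.ofReal ((1 + ‖x‖) ^ (-(4 * b)))) ?_).trans_eq ?_
  · exact ((𝓕 g).continuous.enorm).measurable
  · fun_prop
  · fun_prop
  · intro x
    rw [← ENNReal.ofReal_mul (by positivity), ← Real.rpow_add (pos _)]
    simp
  · rw [← lintegral_add_right_eq_self (μ := volume)
      (fun x : ℝ => ENNReal.ofReal ((1 + ‖x‖) ^ (-(4 * b)))) a]
    refine lintegral_congr fun x => ?_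
    rw [← ENNReal.ofReal_pow (by positivity), ← Real.rpow_natCast, ← Real.rpow_mul (pos _).le]
    congr 2
    push_cast; ring
  · congr 2
    refine lintegral_congr fun x => ?_
    rw [← ofReal_norm, ← ENNReal.ofReal_mul (by positivity), ← ENNReal.ofReal_pow (by positivity),
      mul_pow, ← Real.rpow_natCast, ← Real.rpow_mul (pos _).le]
    congr 3
    push_cast; ring

lemma contDiff_param (n : ℕ) : ∀ F : ℝ × ℝ → ℂ, ContDiff ℝ ∞ F →
    ContDiff ℝ n (fun t => ∫ x in (0:ℝ)..1, F (x, t)) := by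
  have hd : ∀ F : ℝ × ℝ → ℂ, ContDiff ℝ ∞ F → ∀ t₀, HasDerivAt
      (fun t => ∫ x in (0:ℝ)..1, F (x, t)) (∫ x in (0:ℝ)..1, fderiv ℝ F (x, t₀) (0, 1)) t₀ := by
    intro F hF t₀
    have hc : Continuous F := hF.continuous
    have hc' : Continuous (fun p : ℝ × ℝ => fderiv ℝ F p (0, 1)) :=
      (hF.continuous_fderiv (by simp)).clm_apply continuous_const
    obtain ⟨M, hM⟩ := ((isCompact_Icc (a := (0:ℝ)) (b := 1)).prod
      (isCompact_closedBall t₀ 1)).exists_bound_of_continuousOn hc'.continuousOn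
    refine (intervalIntegral.hasDerivAt_integral_of_dominated_loc_of_deriv_le (μ := volume)
      (F := fun t x => F (x, t)) (F' := fun t x => fderiv ℝ F (x, t) (0, 1)) (bound := fun _ => M)
      (Metric.closedBall_mem_nhds t₀ one_pos) ?_ ?_ ?_ ?_ ?_ ?_).2
    · exact Filter.Eventually.of_forall fun t =>
        (Continuous.aestronglyMeasurable (by fun_prop))
    · exact Continuous.intervalIntegrable (by fun_prop) _ _
    · exact Continuous.aestronglyMeasurable (hc'.comp (by fun_prop : Continuous fun x : ℝ => (x, t₀)))
    · refine Filter.Eventually.of_forall fun x hx t ht => hM (x, t) ⟨?_, ht⟩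
      rw [Set.uIoc_of_le zero_le_one] at hx
      exact Set.Ioc_subset_Icc_self hx
    · exact intervalIntegrable_const
    · refine Filter.Eventually.of_forall fun x hx t ht => ?_
      have h1 : HasFDerivAt F (fderiv ℝ F (x, t)) (x, t) :=
        (hF.differentiable (by simp) _).hasFDerivAt
      have h2 : HasDerivAt (fun t : ℝ => (x, t)) (0, 1) t :=
        (hasDerivAt_const t x).prodMk (hasDerivAt_id t)
      exact h1.comp_hasDerivAt t h2
  induction n with
  | zero =>
    intro F hF
    refine contDiff_zero.2 ?_
    exact continuous_iff_continuousAt.2 fun t => (hd F hF t).continuousAt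
  | succ n ih =>
    intro F hF
    rw [show ((n + 1 : ℕ) : WithTop ℕ∞) = (n : WithTop ℕ∞) + 1 by push_cast; rfl,
      contDiff_succ_iff_deriv]
    refine ⟨fun t => (hd F hF t).differentiableAt, by simp, ?_⟩
    have : deriv (fun t => ∫ x in (0:ℝ)..1, F (x, t)) =
        fun t => ∫ x in (0:ℝ)..1, fderiv ℝ F (x, t) (0, 1) := funext fun t => (hd F hF t).deriv
    rw [this]
    exact ih (fun p => fderiv ℝ F p (0, 1))
      ((hF.fderiv_right (m := ∞) (by simp)).clm_apply contDiff_const)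

lemma contDiff_param' (F : ℝ × ℝ → ℂ) (hF : ContDiff ℝ ∞ F) :
    ContDiff ℝ ∞ (fun t => ∫ x in (0:ℝ)..1, F (x, t)) :=
  contDiff_infty.2 fun n => contDiff_param n F hF

lemma minkowski (c : ℤ → ℝ → ℝ≥0∞) (hc : ∀ k, Measurable (c k)) :
    ∫⁻ t, (∑' k, c k t) ^ 2 ≤ (∑' k, (∫⁻ t, c k t ^ 2) ^ ((1:ℝ)/2)) ^ 2 := by
  have e : ∀ t, (∑' k, c k t) ^ 2 = ∑' k, ∑' j, c k t * c j t := by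
    intro t
    simp_rw [ENNReal.tsum_mul_left, ENNReal.tsum_mul_right, sq]
  simp_rw [e]
  rw [lintegral_tsum (fun k => by fun_prop), sq, ← ENNReal.tsum_mul_right]
  refine ENNReal.tsum_le_tsum fun k => ?_
  rw [lintegral_tsum (fun k => by fun_prop), ← ENNReal.tsum_mul_left]
  refine ENNReal.tsum_le_tsum fun j => ?_
  have h := ENNReal.lintegral_mul_le_Lp_mul_Lq volume Real.HolderConjugate.two_two
    (hc k).aemeasurable (hc j).aemeasurable
  simpa only [Pi.mul_apply, ENNReal.rpow_two] using h

lemma parseval (φ : ℝ → ℂ) (hφ : Continuous φ) :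
    ∫⁻ x in Set.Ioc (0:ℝ) 1, ENNReal.ofReal (‖φ x‖ ^ 2) = ∑' k : ℤ, ‖torusCoeff φ k‖ₑ ^ 2 := by
  have hL : MemLp φ 2 (volume.restrict (Set.Ioc (0:ℝ) 1)) := by
    rw [memLp_two_iff_integrable_sq_norm hφ.aestronglyMeasurable]
    exact ((hφ.norm.pow 2).integrableOn_Icc (a := 0) (b := 1)).mono_set Set.Ioc_subset_Icc_self
  have h := hasSum_sq_fourierCoeffOn (zero_lt_one (α := ℝ)) hL
  have e : ∀ k : ℤ, fourierCoeffOn (zero_lt_one (α := ℝ)) φ k = torusCoeff φ k := by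
    intro k
    rw [fourierCoeffOn_eq_integral, torusCoeff]
    simp only [sub_zero, div_one, one_smul]
    refine intervalIntegral.integral_congr fun x _ => ?_
    simp only [smul_eq_mul]
    rw [mul_comm, fourier_coe_apply]
    congr 2
    push_cast; ring
  simp_rw [e] at h
  rw [← ofReal_integral_eq_lintegral_ofReal, ← intervalIntegral.integral_of_le zero_le_one]
  · have h2 := h.tsum_eq
    simp only [sub_zero, inv_one, one_smul] at h2
    rw [← h2, ENNReal.ofReal_tsum_of_nonneg (fun _ => by positivity) h.summable]
    congr 1; ext k
    rw [ENNReal.ofReal_pow (norm_nonneg _), ofReal_norm]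
  · exact hL.integrable_norm_pow (by norm_num)
  · exact Filter.Eventually.of_forall fun x => by positivity

lemma stFT_eq (f : ℝ → ℝ → ℂ) (k : ℤ) (η : ℝ) :
    stFT f k η = 𝓕 (fun t => torusCoeff (fun x => f x t) k) η := by
  rw [Real.fourier_eq', stFT]
  refine integral_congr_ae (Filter.Eventually.of_forall fun t => ?_)
  simp only [torusCoeff, smul_eq_mul]
  rw [← intervalIntegral.integral_const_mul]
  refine intervalIntegral.integral_congr fun x _ => ?_
  rw [mul_left_comm, ← Complex.exp_add]
  congr 2
  simp
  ring

lemma coeff_schwartz (f : ℝ → ℝ → ℂ) (hf : SmoothCptTime f) (k : ℤ) :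
    ∃ g : SchwartzMap ℝ ℂ, ∀ t, g t = torusCoeff (fun x => f x t) k := by
  obtain ⟨h1, -, T, hT⟩ := hf
  have hs : ContDiff ℝ ∞ (fun t => torusCoeff (fun x => f x t) k) := by
    refine contDiff_param' (fun p : ℝ × ℝ => f p.1 p.2 *
      Complex.exp (-(2 * (Real.pi : ℂ)) * Complex.I * (k : ℂ) * (p.1 : ℂ))) ?_
    refine ContDiff.mul h1 (ContDiff.cexp ?_)
    exact contDiff_const.mul (Complex.ofRealCLM.contDiff.comp contDiff_fst)
  have hc : HasCompactSupport (fun t => torusCoeff (fun x => f x t) k) := by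
    refine HasCompactSupport.intro (isCompact_closedBall (0:ℝ) T) fun t ht => ?_
    have : T ≤ |t| := by
      simp only [Metric.mem_closedBall, dist_zero_right, Real.norm_eq_abs, not_le] at ht
      exact ht.le
    simp [torusCoeff, hT _ t this]
  exact ⟨hc.toSchwartzMap hs, fun t => rfl⟩

end XEmb

/-- **`X^{0,b'} ↪ L⁴_t L²_x` for `b' > 1/4`.** There is `C = C(b')` such that
`(∫_ℝ ‖f(·,t)‖_{L²(𝕋)}⁴ dt)^{1/4} ≤ C ‖f‖_{X^{0,b'}}` for every smooth `f` compactly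
supported in time. -/
theorem XNorm_embed_L4tL2x (b' : ℝ) (hb' : 1/4 < b') :
    ∃ C : ℝ, 0 < C ∧ ∀ f : ℝ → ℝ → ℂ, SmoothCptTime f →
      (∫⁻ t : ℝ, (∫⁻ x in Set.Ioc (0:ℝ) 1, ENNReal.ofReal (‖f x t‖ ^ 2)) ^ (2:ℝ)) ^ ((1:ℝ)/4)
        ≤ ENNReal.ofReal C * XNorm 0 b' f := by
  set A : ENNReal := ∫⁻ x : ℝ, ENNReal.ofReal ((1 + ‖x‖) ^ (-(4 * b'))) with hA
  have hAfin : A < ⊤ := finite_integral_one_add_norm (by simp; linarith)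
  refine ⟨A.toReal ^ ((1:ℝ)/4) + 1, by positivity, fun f hf => ?_⟩
  have hC : A ^ ((1:ℝ)/4) ≤ ENNReal.ofReal (A.toReal ^ ((1:ℝ)/4) + 1) := by
    calc A ^ ((1:ℝ)/4) = ENNReal.ofReal (A.toReal ^ ((1:ℝ)/4)) := by
          rw [← ENNReal.ofReal_rpow_of_nonneg ENNReal.toReal_nonneg (by norm_num),
            ENNReal.ofReal_toReal hAfin.ne]
      _ ≤ _ := ENNReal.ofReal_le_ofReal (by linarith)
  refine le_trans ?_ (mul_le_mul_left hC _)
  choose g hg using XEmb.coeff_schwartz f hf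
  have hcont : ∀ t, Continuous (fun x => f x t) := fun t =>
    hf.1.continuous.comp (by fun_prop : Continuous fun x : ℝ => (x, t))
  have e1 : ∀ t, (∫⁻ x in Set.Ioc (0:ℝ) 1, ENNReal.ofReal (‖f x t‖ ^ 2)) ^ (2:ℝ) =
      (∑' k : ℤ, ‖g k t‖ₑ ^ 2) ^ 2 := by
    intro t
    rw [XEmb.parseval _ (hcont t), ENNReal.rpow_two]
    simp_rw [hg]
  simp_rw [e1]
  have hft : ∀ k η, stFT f k η = FourierTransform.fourier (g k) η := by
    intro k η
    rw [XEmb.stFT_eq, SchwartzMap.fourier_coe]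
    rw [show (fun t => torusCoeff (fun x => f x t) k) = ⇑(g k) from
      funext fun t => (hg k t).symm]
  set N : ℤ → ENNReal := fun k => ∫⁻ η : ℝ, ENNReal.ofReal
    ((1 + |η + 2 * Real.pi * (k : ℝ) ^ 2|) ^ (2 * b') * ‖FourierTransform.fourier (g k) η‖ ^ 2)
    with hN
  have hX : XNorm 0 b' f = (∑' k, N k) ^ ((1:ℝ)/2) := by
    rw [XNorm, hN]
    simp [hft]
  rw [hX]
  have hk : ∀ k, (∫⁻ t, (‖g k t‖ₑ ^ 2) ^ 2) ^ ((1:ℝ)/2) ≤ A ^ ((1:ℝ)/2) * N k := by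
    intro k
    have := XEmb.l4_bound b' (2 * Real.pi * (k : ℝ) ^ 2) (g k)
    simp_rw [← pow_mul]
    calc _ ≤ (A * N k ^ 2) ^ ((1:ℝ)/2) := ENNReal.rpow_le_rpow this (by norm_num)
      _ = _ := by
        rw [ENNReal.mul_rpow_of_nonneg _ _ (by norm_num), ← ENNReal.rpow_two (x := N k),
          ← ENNReal.rpow_mul]
        norm_num
  calc _ ≤ ((∑' k, (∫⁻ t, (‖g k t‖ₑ ^ 2) ^ 2) ^ ((1:ℝ)/2)) ^ 2) ^ ((1:ℝ)/4) := by
        refine ENNReal.rpow_le_rpow (XEmb.minkowski (fun k t => ‖g k t‖ₑ ^ 2) fun k => ?_)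
          (by norm_num)
        exact ((g k).continuous.enorm.measurable).pow_const 2
    _ ≤ ((∑' k, A ^ ((1:ℝ)/2) * N k) ^ 2) ^ ((1:ℝ)/4) := by
        refine ENNReal.rpow_le_rpow (pow_le_pow_left' (ENNReal.tsum_le_tsum hk) 2) (by norm_num)
    _ = A ^ ((1:ℝ)/4) * (∑' k, N k) ^ ((1:ℝ)/2) := by
        rw [ENNReal.tsum_mul_left, ← ENNReal.rpow_two, ← ENNReal.rpow_mul,
          ENNReal.mul_rpow_of_nonneg _ _ (by norm_num), ← ENNReal.rpow_mul]
        norm_num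
end

section
/- Let b ∈ (1/2, 1) and ψ ∈ C_c^∞(ℝ). There exists a constant C = C(b,ψ) such that for every δ ∈ (0,1), every a ∈ ℝ, and every Schwartz function h : ℝ → ℂ, the function g(t) = ψ(t/δ) h(t) satisfies ∫_ℝ |ĝ(η)|² (1+|η+a|)^{2b} dη ≤ C δ^{1−2b} ∫_ℝ |ĥ(η)|² (1+|η+a|)^{2b} dη. -/
open MeasureTheory

/-- The Fourier transform on `ℝ`: `ĥ(η) = ∫_ℝ h(t) e^{-2πiηt} dt`. -/
noncomputable def FT1 (h : ℝ → ℂ) (η : ℝ) : ℂ :=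
  ∫ t : ℝ, h t * Complex.exp (-(2 * (Real.pi : ℂ)) * Complex.I * (η : ℂ) * (t : ℂ))

open scoped ENNReal FourierTransform

lemma cs_enn {f g : ℝ → ℝ≥0∞} (hf : Measurable f) (hg : Measurable g) :
    (∫⁻ x, f x * g x) ^ 2 ≤ (∫⁻ x, f x ^ 2) * ∫⁻ x, g x ^ 2 := by
  have h := ENNReal.lintegral_mul_le_Lp_mul_Lq volume Real.HolderConjugate.two_two
    hf.aemeasurable hg.aemeasurable
  simp only [Pi.mul_apply, ENNReal.rpow_two] at h
  have h2 := pow_le_pow_left' h 2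
  refine h2.trans_eq ?_
  rw [mul_pow, ← ENNReal.rpow_natCast, ← ENNReal.rpow_natCast, ← ENNReal.rpow_mul,
    ← ENNReal.rpow_mul]
  norm_num

lemma cs_weight_s12 {k F : ℝ → ℝ≥0∞} (hk : Measurable k) (hF : Measurable F) :
    (∫⁻ x, k x * F x) ^ 2 ≤ (∫⁻ x, k x) * ∫⁻ x, k x * F x ^ 2 := by
  have hs : ∀ x, (k x ^ (1/2 : ℝ)) ^ 2 = k x := fun x => by
    rw [← ENNReal.rpow_natCast, ← ENNReal.rpow_mul]; norm_num
  have h := cs_enn (f := fun x => k x ^ (1/2 : ℝ)) (g := fun x => k x ^ (1/2 : ℝ) * F x)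
    (by fun_prop) (by fun_prop)
  simp only [mul_pow, hs, ← mul_assoc, ← sq] at h
  exact h

lemma young_enn {K F : ℝ → ℝ≥0∞} (hK : Measurable K) (hF : Measurable F) :
    ∫⁻ η, (∫⁻ ξ, K (η - ξ) * F ξ) ^ 2 ≤ (∫⁻ x, K x) ^ 2 * ∫⁻ x, F x ^ 2 := by
  calc ∫⁻ η, (∫⁻ ξ, K (η - ξ) * F ξ) ^ 2
      ≤ ∫⁻ η, (∫⁻ x, K x) * ∫⁻ ξ, K (η - ξ) * F ξ ^ 2 := by
        refine lintegral_mono fun η => ?_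
        refine (cs_weight_s12 (by fun_prop) hF).trans_eq ?_
        rw [lintegral_sub_left_eq_self K η]
    _ = (∫⁻ x, K x) * ∫⁻ ξ, ∫⁻ η, K (η - ξ) * F ξ ^ 2 := by
        rw [lintegral_const_mul, lintegral_lintegral_swap]
        · exact Measurable.aemeasurable (by fun_prop)
        · exact Measurable.lintegral_prod_right' (f := fun p : ℝ × ℝ => K (p.1 - p.2) * F p.2 ^ 2) (by fun_prop)
    _ = (∫⁻ x, K x) * ∫⁻ ξ, (∫⁻ x, K x) * F ξ ^ 2 := by
        congr 1
        refine lintegral_congr fun ξ => ?_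
        rw [lintegral_mul_const _ (by fun_prop), lintegral_sub_right_eq_self K ξ]
    _ = _ := by
        rw [lintegral_const_mul _ (by fun_prop), ← mul_assoc, sq]

lemma scale_enn {K : ℝ → ℝ≥0∞} (hK : Measurable K) {δ : ℝ} (hδ : 0 < δ) :
    ENNReal.ofReal δ * ∫⁻ x, K (δ * x) = ∫⁻ x, K x := by
  have h := Real.smul_map_volume_mul_left hδ.ne'
  conv_rhs => rw [← h]
  rw [lintegral_smul_measure, lintegral_map hK (by fun_prop), abs_of_pos hδ, smul_eq_mul]


lemma FT1_eq_fourier (f : ℝ → ℂ) (η : ℝ) : FT1 f η = 𝓕 f η := by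
  rw [Real.fourier_real_eq_integral_exp_smul, FT1]
  refine integral_congr_ae (Filter.Eventually.of_forall fun t => ?_)
  simp only [smul_eq_mul]
  rw [mul_comm]
  congr 2
  push_cast
  ring

lemma FT1_scale (ψ : ℝ → ℂ) {δ : ℝ} (hδ : 0 < δ) (η : ℝ) :
    FT1 (fun t => ψ (t / δ)) η = (δ : ℂ) * FT1 ψ (δ * η) := by
  unfold FT1
  have h := Measure.integral_comp_div (fun t : ℝ => ψ t * Complex.exp
    (-(2 * (Real.pi : ℂ)) * Complex.I * ((δ * η : ℝ) : ℂ) * (t : ℂ))) δ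
  rw [abs_of_pos hδ, Complex.real_smul] at h
  rw [← h]
  refine integral_congr_ae (Filter.Eventually.of_forall fun t => ?_)
  have : (δ : ℂ) ≠ 0 := by exact_mod_cast hδ.ne'
  simp only
  congr 2
  push_cast
  field_simp

lemma FT1_mul (ψ : ℝ → ℂ) (hψ : ContDiff ℝ (⊤ : ℕ∞) ψ) (hψc : HasCompactSupport ψ)
    (h : SchwartzMap ℝ ℂ) (η : ℝ) :
    FT1 (fun t => ψ t * h t) η = ∫ ξ, (𝓕 h) ξ * FT1 ψ (η - ξ) := by
  set G : ℝ → ℂ := fun t => ψ t *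
    Complex.exp (-(2 * (Real.pi : ℂ)) * Complex.I * (η : ℂ) * (t : ℂ)) with hG
  have hGs : ContDiff ℝ (⊤ : ℕ∞) G := by
    refine hψ.mul (ContDiff.cexp ?_)
    exact contDiff_const.mul Complex.ofRealCLM.contDiff
  have hGc : HasCompactSupport G := hψc.mul_right
  have key := SchwartzMap.integral_fourierInv_mul_eq (𝓕 h) (hGc.toSchwartzMap hGs)
  rw [FourierTransform.fourierInv_fourier_eq] at key
  have e1 : FT1 (fun t => ψ t * h t) η = ∫ ξ, h ξ * (hGc.toSchwartzMap hGs) ξ := by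
    unfold FT1
    refine integral_congr_ae (Filter.Eventually.of_forall fun t => ?_)
    change _ = h t * (ψ t * _)
    simp only
    ring
  rw [e1, key]
  refine integral_congr_ae (Filter.Eventually.of_forall fun ξ => ?_)
  simp only
  congr 1
  rw [SchwartzMap.fourierInv_coe, Real.fourierInv_eq', FT1]
  refine integral_congr_ae (Filter.Eventually.of_forall fun t => ?_)
  change _ * (ψ t * _) = _
  rw [mul_left_comm, ← Complex.exp_add]
  congr 2
  simp
  ring

lemma FT1_mul_bound (ψ : ℝ → ℂ) (hψ : ContDiff ℝ (⊤ : ℕ∞) ψ) (hψc : HasCompactSupport ψ)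
    {δ : ℝ} (hδ : 0 < δ) (h : SchwartzMap ℝ ℂ) (η : ℝ) :
    ‖FT1 (fun t => ψ (t / δ) * h t) η‖ₑ ≤
      ∫⁻ ξ, (ENNReal.ofReal δ * ‖FT1 ψ (δ * (η - ξ))‖ₑ) * ‖FT1 (fun t => h t) ξ‖ₑ := by
  have hs : ContDiff ℝ (⊤ : ℕ∞) (fun t : ℝ => ψ (t / δ)) :=
    hψ.comp (contDiff_id.div_const δ)
  have hc : HasCompactSupport (fun t : ℝ => ψ (t / δ)) := by
    have := hψc.comp_homeomorph (Homeomorph.mulRight₀ δ⁻¹ (inv_ne_zero hδ.ne'))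
    simpa [Function.comp_def, div_eq_mul_inv] using this
  rw [FT1_mul _ hs hc h η]
  refine (enorm_integral_le_lintegral_enorm _).trans_eq ?_
  refine lintegral_congr fun ξ => ?_
  rw [FT1_scale ψ hδ, enorm_mul, enorm_mul, FT1_eq_fourier (fun t => h t) ξ, mul_comm,
    SchwartzMap.fourier_coe]
  congr 2
  rw [← ofReal_norm, Complex.norm_real, Real.norm_of_nonneg hδ.le]

lemma c2_finite (Φ : SchwartzMap ℝ ℂ) {b : ℝ} (hb0 : 0 ≤ b) (hb1 : b ≤ 1) :
    ∫⁻ x, (‖Φ x‖ₑ * ENNReal.ofReal (|x| ^ b)) ^ 2 < ∞ := by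
  set M := SchwartzMap.seminorm ℂ 0 0 Φ + SchwartzMap.seminorm ℂ 1 0 Φ with hM
  have hint : Integrable (fun x : ℝ => M * (‖x‖ ^ 0 * ‖Φ x‖ + ‖x‖ ^ 1 * ‖Φ x‖)) :=
    ((Φ.integrable_pow_mul volume 0).add (Φ.integrable_pow_mul volume 1)).const_mul M
  refine lt_of_le_of_lt (lintegral_mono fun x => ?_) hint.lintegral_lt_top
  rw [← ofReal_norm, ← ENNReal.ofReal_mul (norm_nonneg _), ← ENNReal.ofReal_pow (by positivity)]
  apply ENNReal.ofReal_le_ofReal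
  have h0 := SchwartzMap.norm_pow_mul_le_seminorm ℂ Φ 0 x
  have h1 := SchwartzMap.norm_pow_mul_le_seminorm ℂ Φ 1 x
  have hx : |x| ^ b ≤ 1 + |x| := by
    calc |x| ^ b ≤ (1 + |x|) ^ b := Real.rpow_le_rpow (abs_nonneg _) (by linarith) hb0
      _ ≤ (1 + |x|) ^ (1 : ℝ) := Real.rpow_le_rpow_of_exponent_le (by linarith [abs_nonneg x]) hb1
      _ = _ := Real.rpow_one _
  rw [Real.norm_eq_abs] at *
  have hp : ‖Φ x‖ * |x| ^ b ≤ |x| ^ 0 * ‖Φ x‖ + |x| ^ 1 * ‖Φ x‖ := by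
    nlinarith [norm_nonneg (Φ x)]
  have hq : 0 ≤ ‖Φ x‖ * |x| ^ b := by positivity
  rw [sq]
  exact mul_le_mul (by linarith) hp hq (by linarith)

lemma weight_le {b : ℝ} (hb0 : 0 ≤ b) (hb1 : b ≤ 1) (a η ξ : ℝ) :
    ENNReal.ofReal ((1 + |η + a|) ^ b) ≤
      ENNReal.ofReal ((1 + |ξ + a|) ^ b) + ENNReal.ofReal (|η - ξ| ^ b) := by
  rw [← ENNReal.ofReal_add (by positivity) (by positivity)]
  apply ENNReal.ofReal_le_ofReal
  refine le_trans ?_ (Real.rpow_add_le_add_rpow (by positivity) (abs_nonneg _) hb0 hb1)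
  apply Real.rpow_le_rpow (by positivity) _ hb0
  have := abs_add_le (ξ + a) (η - ξ)
  have e : ξ + a + (η - ξ) = η + a := by ring
  rw [e] at this
  linarith

lemma integrand_eq (z : ℂ) (y b : ℝ) :
    ENNReal.ofReal (‖z‖ ^ 2 * (1 + |y|) ^ (2 * b)) =
      (‖z‖ₑ * ENNReal.ofReal ((1 + |y|) ^ b)) ^ 2 := by
  rw [← ofReal_norm, ← ENNReal.ofReal_mul (norm_nonneg _), ← ENNReal.ofReal_pow (by positivity),
    mul_pow]
  congr 2
  rw [← Real.rpow_natCast, ← Real.rpow_mul (by positivity), mul_comm]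
  norm_num

lemma l1_bound {b : ℝ} (a : ℝ) {F : ℝ → ℝ≥0∞} (hF : Measurable F) :
    (∫⁻ ξ, F ξ) ^ 2 ≤ (∫⁻ x : ℝ, ENNReal.ofReal ((1 + ‖x‖) ^ (-(2 * b)))) *
      ∫⁻ ξ, (F ξ * ENNReal.ofReal ((1 + |ξ + a|) ^ b)) ^ 2 := by
  have h := cs_enn (f := fun ξ => ENNReal.ofReal ((1 + |ξ + a|) ^ (-b)))
    (g := fun ξ => F ξ * ENNReal.ofReal ((1 + |ξ + a|) ^ b)) (by fun_prop) (by fun_prop)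
  have e1 : ∀ ξ, ENNReal.ofReal ((1 + |ξ + a|) ^ (-b)) *
      (F ξ * ENNReal.ofReal ((1 + |ξ + a|) ^ b)) = F ξ := fun ξ => by
    rw [mul_left_comm, ← ENNReal.ofReal_mul (by positivity), ← Real.rpow_add (by positivity)]
    simp
  have e2 : ∀ ξ, ENNReal.ofReal ((1 + |ξ + a|) ^ (-b)) ^ 2 =
      ENNReal.ofReal ((1 + ‖ξ + a‖) ^ (-(2 * b))) := fun ξ => by
    rw [← ENNReal.ofReal_pow (by positivity), ← Real.rpow_natCast,
      ← Real.rpow_mul (by positivity), Real.norm_eq_abs]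
    congr 2
    push_cast
    ring
  simp only [e1, e2] at h
  rwa [lintegral_add_right_eq_self (fun x : ℝ => ENNReal.ofReal ((1 + ‖x‖) ^ (-(2 * b)))) a] at h

/-- **One-dimensional time-localization multiplier bound.** Let `b ∈ (1/2,1)` and
`ψ ∈ C_c^∞(ℝ)`. There is `C = C(b,ψ)` such that for every `δ ∈ (0,1)`, every `a ∈ ℝ`
and every Schwartz function `h`, the function `g(t) = ψ(t/δ) h(t)` satisfies
`∫ |ĝ(η)|² (1+|η+a|)^{2b} dη ≤ C δ^{1-2b} ∫ |ĥ(η)|² (1+|η+a|)^{2b} dη`. -/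
theorem time_localization_multiplier_bound (b : ℝ) (hb : b ∈ Set.Ioo (1/2 : ℝ) 1)
    (ψ : ℝ → ℂ) (hψ : ContDiff ℝ (⊤ : ℕ∞) ψ) (hψc : HasCompactSupport ψ) :
    ∃ C : ℝ, 0 < C ∧ ∀ δ : ℝ, δ ∈ Set.Ioo (0:ℝ) 1 → ∀ a : ℝ, ∀ h : SchwartzMap ℝ ℂ,
      (∫⁻ η : ℝ, ENNReal.ofReal
          (‖FT1 (fun t => ψ (t / δ) * h t) η‖ ^ 2 * (1 + |η + a|) ^ (2 * b)))
        ≤ ENNReal.ofReal (C * δ ^ (1 - 2 * b)) *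
          ∫⁻ η : ℝ, ENNReal.ofReal (‖FT1 (fun t => h t) η‖ ^ 2 * (1 + |η + a|) ^ (2 * b)) := by
  
  obtain ⟨hb0, hb1⟩ := hb
  set Φ : SchwartzMap ℝ ℂ := 𝓕 (hψc.toSchwartzMap hψ) with hΦ
  have hΦe : ∀ η, FT1 ψ η = Φ η := fun η => by
    rw [FT1_eq_fourier, hΦ, SchwartzMap.fourier_coe]; rfl
  set c1 := ∫⁻ x, ‖Φ x‖ₑ with hc1
  set c2 := ∫⁻ x, (‖Φ x‖ₑ * ENNReal.ofReal (|x| ^ b)) ^ 2 with hc2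
  set c3 := ∫⁻ x : ℝ, ENNReal.ofReal ((1 + ‖x‖) ^ (-(2 * b))) with hc3
  have f1 : c1 < ∞ := Φ.integrable.2
  have f2 : c2 < ∞ := c2_finite Φ (by linarith) hb1.le
  have f3 : c3 < ∞ := finite_integral_one_add_norm (by simp; linarith)
  have fC : 2 * (c1 ^ 2 + c3 * c2) < ∞ := by
    refine ENNReal.mul_lt_top (by simp) (ENNReal.add_lt_top.2 ⟨?_, ENNReal.mul_lt_top f3 f2⟩)
    exact ENNReal.pow_lt_top f1
  refine ⟨(2 * (c1 ^ 2 + c3 * c2)).toReal + 1, by positivity, ?_⟩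
  rintro δ ⟨hδ0, hδ1⟩ a h
  simp only [integrand_eq]
  set R := ∫⁻ η, (‖FT1 (fun t => h t) η‖ₑ * ENNReal.ofReal ((1 + |η + a|) ^ b)) ^ 2 with hR
  have hmΦ : Measurable fun x => ‖Φ x‖ₑ := Φ.continuous.enorm.measurable
  have hmH : Measurable fun x => ‖FT1 (fun t => h t) x‖ₑ := by
    have : ∀ x, FT1 (fun t => h t) x = (𝓕 h) x := fun x => by
      rw [FT1_eq_fourier, SchwartzMap.fourier_coe]
    simp only [this]
    exact (𝓕 h).continuous.enorm.measurable
  set K : ℝ → ℝ≥0∞ := fun x => ENNReal.ofReal δ * ‖Φ (δ * x)‖ₑ with hK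
  have hmK : Measurable K := (hmΦ.comp (measurable_const_mul δ)).const_mul _
  set KB : ℝ → ℝ≥0∞ := fun x => K x * ENNReal.ofReal (|x| ^ b) with hKB
  have hmKB : Measurable KB := hmK.mul (by fun_prop)
  set F : ℝ → ℝ≥0∞ := fun ξ => ‖FT1 (fun t => h t) ξ‖ₑ with hF
  set w : ℝ → ℝ≥0∞ := fun ξ => ENNReal.ofReal ((1 + |ξ + a|) ^ b) with hw
  have hmw : Measurable w := by fun_prop
  have iK : ∫⁻ x, K x = c1 := by
    rw [hc1, ← scale_enn hmΦ hδ0, hK, lintegral_const_mul]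
    exact hmΦ.comp (measurable_const_mul δ)
  set P : ℝ → ℝ≥0∞ := fun x => (‖Φ x‖ₑ * ENNReal.ofReal (|x| ^ b)) ^ 2 with hP
  have hmP : Measurable P := (hmΦ.mul (by fun_prop)).pow_const 2
  have eKB : ∀ x, KB x ^ 2 = ENNReal.ofReal (δ ^ (1 - 2 * b)) * (ENNReal.ofReal δ * P (δ * x)) := by
    intro x
    simp only [hKB, hK, hP]
    rw [abs_mul, abs_of_pos hδ0, Real.mul_rpow hδ0.le (abs_nonneg _),
      ENNReal.ofReal_mul (by positivity)]
    have : ENNReal.ofReal δ ^ 2 = ENNReal.ofReal (δ ^ (1 - 2 * b)) * ENNReal.ofReal δ *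
        ENNReal.ofReal (δ ^ b) ^ 2 := by
      rw [← ENNReal.ofReal_pow hδ0.le, ← ENNReal.ofReal_pow (by positivity),
        ← ENNReal.ofReal_mul (by positivity), ← ENNReal.ofReal_mul (by positivity)]
      congr 1
      rw [← Real.rpow_natCast (δ ^ b), ← Real.rpow_mul hδ0.le]
      nth_rewrite 3 [← Real.rpow_one δ]
      rw [← Real.rpow_add hδ0, ← Real.rpow_add hδ0, ← Real.rpow_natCast]
      congr 1
      push_cast
      ring
    rw [mul_pow, mul_pow, this]
    ring
  have iKB : ∫⁻ x, KB x ^ 2 = ENNReal.ofReal (δ ^ (1 - 2 * b)) * c2 := by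
    simp only [eKB]
    have hmP' : Measurable fun x => P (δ * x) := hmP.comp (measurable_const_mul δ)
    rw [lintegral_const_mul _ (hmP'.const_mul _), lintegral_const_mul _ hmP', scale_enn hmP hδ0]
  set A : ℝ → ℝ≥0∞ := fun η => ∫⁻ ξ, K (η - ξ) * (F ξ * w ξ) with hA
  set B : ℝ → ℝ≥0∞ := fun η => ∫⁻ ξ, F (η - ξ) * KB ξ with hB
  have hmA : Measurable A := Measurable.lintegral_prod_right'
    (f := fun p : ℝ × ℝ => K (p.1 - p.2) * (F p.2 * w p.2)) (by fun_prop)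
  have hAi : ∫⁻ η, A η ^ 2 ≤ c1 ^ 2 * R := by
    have := young_enn hmK (hmH.mul hmw)
    rw [iK] at this
    exact this
  have hBi : ∫⁻ η, B η ^ 2 ≤ c3 * R * (ENNReal.ofReal (δ ^ (1 - 2 * b)) * c2) := by
    have := young_enn hmH hmKB
    rw [iKB] at this
    exact this.trans (mul_le_mul' (l1_bound a hmH) le_rfl)
  have hpt : ∀ η, ‖FT1 (fun t => ψ (t / δ) * h t) η‖ₑ * w η ≤ A η + B η := by
    intro η
    have hBe : B η = ∫⁻ ξ, KB (η - ξ) * F ξ := by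
      rw [hB, ← lintegral_sub_left_eq_self (fun ξ => KB (η - ξ) * F ξ) η]
      refine lintegral_congr fun ξ => ?_
      rw [sub_sub_cancel, mul_comm]
    rw [hBe, hA, ← lintegral_add_left (by fun_prop)]
    refine (mul_le_mul' (FT1_mul_bound ψ hψ hψc hδ0 h η) le_rfl).trans ?_
    rw [← lintegral_mul_const' _ _ (by simp [hw])]
    refine lintegral_mono fun ξ => ?_
    simp only [hΦe]
    calc K (η - ξ) * F ξ * w η ≤ K (η - ξ) * F ξ * (w ξ + ENNReal.ofReal (|η - ξ| ^ b)) :=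
          mul_le_mul' le_rfl (weight_le (by linarith) hb1.le a η ξ)
      _ = _ := by simp only [hKB]; ring
  have hδ2 : 1 ≤ ENNReal.ofReal (δ ^ (1 - 2 * b)) := by
    rw [ENNReal.one_le_ofReal]
    exact Real.one_le_rpow_of_pos_of_le_one_of_nonpos hδ0 hδ1.le (by linarith)
  have hsq : ∀ x y : ℝ≥0∞, (x + y) ^ 2 ≤ 2 * (x ^ 2 + y ^ 2) := by
    intro x y
    have := ENNReal.rpow_add_le_mul_rpow_add_rpow x y (p := 2) (by norm_num)
    norm_num at this
    exact this
  calc ∫⁻ η, (‖FT1 (fun t => ψ (t / δ) * h t) η‖ₑ * w η) ^ 2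
      ≤ ∫⁻ η, 2 * (A η ^ 2 + B η ^ 2) :=
        lintegral_mono fun η => (pow_le_pow_left' (hpt η) 2).trans (hsq _ _)
    _ = 2 * ((∫⁻ η, A η ^ 2) + ∫⁻ η, B η ^ 2) := by
        rw [lintegral_const_mul' _ _ (by simp), lintegral_add_left (hmA.pow_const 2)]
    _ ≤ 2 * (ENNReal.ofReal (δ ^ (1 - 2 * b)) * (c1 ^ 2 * R) +
          c3 * R * (ENNReal.ofReal (δ ^ (1 - 2 * b)) * c2)) := by
        gcongr
        exact hAi.trans (le_mul_of_one_le_left' hδ2)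
    _ = 2 * (c1 ^ 2 + c3 * c2) * ENNReal.ofReal (δ ^ (1 - 2 * b)) * R := by ring
    _ ≤ _ := by
        rw [ENNReal.ofReal_mul (by positivity)]
        gcongr
        rw [← ENNReal.ofReal_toReal fC.ne]
        exact ENNReal.ofReal_le_ofReal (by rw [ENNReal.toReal_ofReal (by positivity)]; linarith)
end
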